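/- arXiv:2601.07097 — 2 statements merged into one kernel-verified Lean document; each statement's English description precedes it below -/
import Mathlib

section
/- Fix a base b ≥ 2 and let Q*_b(x) denote the number of n ∈ 𝒫*_b(x) that are square-free. Then for every A > 0, Q*_b(x) = (#𝒫*_b(x)/ζ(2)) · ∏_{p ∣ b³−b} (1 − 1/p²)^{−1} · (1 + O_{b,A}(1/(log x)^A)) as x → ∞, where ζ is the Riemann zeta function and the product runs over primes p dividing b³ − b. -/
/-- A positive integer `n` is a base-`b` palindrome if `b ∤ n` and its base-`b`
digit string reads the same forwards and backwards. -/
def IsBPalindrome (b n : ℕ) : Prop := ¬ b ∣ n ∧ (Nat.digits b n).Palindrome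

/-- `𝒫*_b(x)`: base-`b` palindromes `n ≤ x` with `gcd(n, b³ - b) = 1`. -/
def PstarSet (b : ℕ) (x : ℝ) : Set ℕ :=
  {n : ℕ | 0 < n ∧ (n : ℝ) ≤ x ∧ IsBPalindrome b n ∧ Nat.gcd n (b ^ 3 - b) = 1}

/-- `Q*_b(x)`: the number of square-free members of `𝒫*_b(x)`. -/
noncomputable def QstarCount (b : ℕ) (x : ℝ) : ℕ :=
  {n : ℕ | n ∈ PstarSet b x ∧ Squarefree n}.ncard
namespace SquarefreePalindromes

open Finset

/-- The base-`b` palindromic digit strings of length `N` (leading zeros allowed), as numbers. -/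
def pal (b : ℕ) : ℕ → Finset ℕ
  | 0 => {0}
  | 1 => range b
  | N + 2 => (range b ×ˢ pal b N).image fun p => p.1 * (b ^ (N + 1) + 1) + b * p.2

lemma mem_pal_add_two {b N n : ℕ} :
    n ∈ pal b (N + 2) ↔ ∃ c W, c < b ∧ W ∈ pal b N ∧ n = c * (b ^ (N + 1) + 1) + b * W := by
  simp only [pal, mem_image, mem_product, mem_range, Prod.exists]
  constructor
  · rintro ⟨c, W, ⟨h1, h2⟩, h3⟩
    exact ⟨c, W, h1, h2, h3.symm⟩
  · rintro ⟨c, W, h1, h2, h3⟩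
    exact ⟨c, W, ⟨h1, h2⟩, h3.symm⟩

lemma inner_lt {b N c W : ℕ} (hc : c < b) (hW : W < b ^ N) : c + b * W < b ^ (N + 1) := by
  have : b * (W + 1) ≤ b * b ^ N := Nat.mul_le_mul_left _ hW
  rw [pow_succ']
  nlinarith

lemma pal_lt {b : ℕ} : ∀ {N n : ℕ}, n ∈ pal b N → n < b ^ N
  | 0, n, h => by simp_all [pal]
  | 1, n, h => by simpa [pal] using h
  | N + 2, n, h => by
    obtain ⟨c, W, hc, hW, rfl⟩ := mem_pal_add_two.1 h
    have h1 := inner_lt hc (pal_lt hW)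
    have h2 : (c + 1) * b ^ (N + 1) ≤ b * b ^ (N + 1) := Nat.mul_le_mul_right _ hc
    rw [pow_succ' b (N + 1)]
    nlinarith

lemma zero_mem_pal {b : ℕ} (hb : 2 ≤ b) : ∀ N : ℕ, 0 ∈ pal b N
  | 0 => by simp [pal]
  | 1 => by simp [pal]; omega
  | N + 2 => mem_pal_add_two.2 ⟨0, 0, by omega, zero_mem_pal hb N, by simp⟩

lemma outer_div {b N c W : ℕ} (hc : c < b) (hW : W < b ^ N) :
    (c * (b ^ (N + 1) + 1) + b * W) / b ^ (N + 1) = c := by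
  have h1 := inner_lt hc hW
  have hb : 0 < b := by omega
  have : c * (b ^ (N + 1) + 1) + b * W = (c + b * W) + b ^ (N + 1) * c := by ring
  rw [this, Nat.add_mul_div_left _ _ (by positivity), Nat.div_eq_of_lt h1, zero_add]

lemma outer_injective {b N c c' W W' : ℕ} (hc : c < b) (hc' : c' < b) (hW : W ∈ pal b N)
    (hW' : W' ∈ pal b N) (h : c * (b ^ (N + 1) + 1) + b * W = c' * (b ^ (N + 1) + 1) + b * W') :
    c = c' ∧ W = W' := by
  have h3 : c = c' := by rw [← outer_div hc (pal_lt hW), ← outer_div hc' (pal_lt hW'), h]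
  subst h3
  have hb : 0 < b := by omega
  exact ⟨rfl, Nat.eq_of_mul_eq_mul_left hb (by omega)⟩

lemma outer_div_pow {b M s c W : ℕ} (hs : s ≤ M) (hc : c < b) :
    (c * (b ^ (M + 1) + 1) + b * W) / b ^ ((M - s) + 1) = c * b ^ s + W / b ^ (M - s) := by
  have hb : 0 < b := by omega
  have e3 : c * (b ^ (M + 1) + 1) + b * W = c + b * (c * b ^ s * b ^ (M - s) + W) := by
    rw [mul_assoc c, ← pow_add, show s + (M - s) = M by omega]
    ring
  rw [e3, pow_succ', ← Nat.div_div_eq_div_mul, Nat.add_mul_div_left _ _ hb,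
    Nat.div_eq_of_lt hc, zero_add, add_comm, Nat.add_mul_div_right _ _ (by positivity), add_comm]

lemma sum_pal_add_two {M : Type*} [AddCommMonoid M] (b N : ℕ) (f : ℕ → M) :
    ∑ n ∈ pal b (N + 2), f n =
      ∑ c ∈ range b, ∑ W ∈ pal b N, f (c * (b ^ (N + 1) + 1) + b * W) := by
  rw [← sum_product', pal, sum_image]
  rintro ⟨c, W⟩ h ⟨c', W'⟩ h' heq
  simp only [coe_product, Set.mem_prod, mem_coe, mem_range] at h h'
  obtain ⟨rfl, rfl⟩ := outer_injective h.1 h'.1 h.2 h'.2 heq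
  rfl

lemma card_pal_le (b : ℕ) : ∀ N : ℕ, (pal b N).card ≤ b ^ ((N + 1) / 2)
  | 0 => by simp [pal]
  | 1 => by simp [pal]
  | N + 2 => by
    have h : (N + 2 + 1) / 2 = (N + 1) / 2 + 1 := by omega
    rw [card_eq_sum_ones, sum_pal_add_two, h, pow_succ']
    simp only [sum_const, card_range, smul_eq_mul, mul_one]
    exact Nat.mul_le_mul_left _ (card_pal_le b N)

lemma mem_pal_iff {b : ℕ} : ∀ {N n : ℕ}, n ∈ pal b N ↔
    ∃ l : List ℕ, l.Palindrome ∧ l.length = N ∧ (∀ d ∈ l, d < b) ∧ Nat.ofDigits b l = n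
  | 0, n => by
    simp only [pal, mem_singleton]
    constructor
    · rintro rfl
      exact ⟨[], .nil, rfl, by simp, by simp⟩
    · rintro ⟨l, -, h, -, h'⟩
      rw [List.length_eq_zero_iff.1 h] at h'
      simpa using h'.symm
  | 1, n => by
    simp only [pal, mem_range]
    constructor
    · intro h
      exact ⟨[n], .singleton n, rfl, by simpa using h, by simp⟩
    · rintro ⟨l, -, h, h1, h'⟩
      obtain ⟨a, rfl⟩ := List.length_eq_one_iff.1 h
      simp_all
  | N + 2, n => by
    rw [mem_pal_add_two]
    constructor
    · rintro ⟨c, W, hc, hW, rfl⟩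
      obtain ⟨l, h1, h2, h3, rfl⟩ := mem_pal_iff.1 hW
      refine ⟨c :: (l ++ [c]), .cons_concat c h1, by simp [h2], ?_, ?_⟩
      · intro d hd
        simp only [List.mem_cons, List.mem_append, List.not_mem_nil, or_false] at hd
        rcases hd with rfl | hd | rfl
        · exact hc
        · exact h3 d hd
        · exact hc
      · rw [Nat.ofDigits_cons, Nat.ofDigits_append, h2]
        simp only [Nat.ofDigits_singleton]
        ring
    · rintro ⟨l, h1, h2, h3, rfl⟩
      cases h1 with
      | nil => simp at h2
      | singleton => simp at h2
      | @cons_concat c l h1 =>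
        have h4 : l.length = N := by simpa using h2
        refine ⟨c, Nat.ofDigits b l, h3 c (by simp),
          mem_pal_iff.2 ⟨l, h1, h4, fun d hd => h3 d (by simp [hd]), rfl⟩, ?_⟩
        rw [Nat.ofDigits_cons, Nat.ofDigits_append, h4]
        simp only [Nat.ofDigits_singleton]
        ring

lemma mem_pal_of_palindrome {b n : ℕ} (hb : 2 ≤ b) (h : (b.digits n).Palindrome) :
    n ∈ pal b (b.digits n).length :=
  mem_pal_iff.2 ⟨_, h, rfl, fun _ hd => Nat.digits_lt_base hb hd, Nat.ofDigits_digits b n⟩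

lemma digits_of_mem_pal {b N n : ℕ} (hb : 2 ≤ b) (h : n ∈ pal b N) (hn : ¬ b ∣ n) :
    (b.digits n).Palindrome ∧ (b.digits n).length = N := by
  obtain ⟨l, h1, h2, h3, rfl⟩ := mem_pal_iff.1 h
  suffices b.digits (Nat.ofDigits b l) = l by rw [this]; exact ⟨h1, h2⟩
  refine Nat.digits_ofDigits b hb l h3 fun hl => ?_
  have hrev := h1.reverse_eq
  rw [← List.head_reverse (by simpa using hl)]
  intro h0
  apply hn
  simp only [hrev] at h0
  obtain ⟨a, l', rfl⟩ := List.exists_cons_of_ne_nil hl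
  simp only [List.head_cons] at h0
  rw [h0, Nat.ofDigits_cons]
  simp

/-- Palindromes sharing their first `s` digits differ by `b ^ s` times a difference of
shorter palindromes. -/
lemma sub_eq_of_prefix_eq {b : ℕ} : ∀ {s N n n' : ℕ}, 2 * s ≤ N → n ∈ pal b N → n' ∈ pal b N →
    n / b ^ (N - s) = n' / b ^ (N - s) →
    ∃ W ∈ pal b (N - 2 * s), ∃ W' ∈ pal b (N - 2 * s), (n : ℤ) - n' = b ^ s * ((W : ℤ) - W')
  | 0, N, n, n', _, h, h', _ => ⟨n, h, n', h', by simp⟩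
  | s + 1, N, n, n', hs, h, h', heq => by
    obtain ⟨M, rfl⟩ : ∃ M, N = M + 2 := ⟨N - 2, by omega⟩
    obtain ⟨c, W, hc, hW, rfl⟩ := mem_pal_add_two.1 h
    obtain ⟨c', W', hc', hW', rfl⟩ := mem_pal_add_two.1 h'
    have hb : 0 < b := by omega
    have e1 : M + 2 - (s + 1) = (M - s) + 1 := by omega
    have e2 : M + 2 - 2 * (s + 1) = M - 2 * s := by omega
    rw [e1] at heq
    have hcc : c = c' := by
      have h1 := congrArg (· / b ^ s) heq
      simp only [Nat.div_div_eq_div_mul, ← pow_add] at h1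
      rw [show M - s + 1 + s = M + 1 by omega, outer_div hc (pal_lt hW),
        outer_div hc' (pal_lt hW')] at h1
      exact h1
    subst hcc
    rw [outer_div_pow (by omega) hc, outer_div_pow (by omega) hc] at heq
    obtain ⟨X, hX, X', hX', hXX⟩ :=
      sub_eq_of_prefix_eq (s := s) (by omega) hW hW' (by omega)
    rw [e2]
    refine ⟨X, hX, X', hX', ?_⟩
    push_cast
    linear_combination (b : ℤ) * hXX

lemma exists_digits {b : ℕ} : ∀ {T L W : ℕ}, 2 * T ≤ L → W ∈ pal b L →
    ∃ c : ℕ → ℕ, (∀ i < T, c i < b) ∧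
      (∃ A, W = ∑ i ∈ range T, c i * b ^ i + b ^ T * A) ∧
      ∃ B < b ^ (L - T), W = (∑ i ∈ range T, c i * b ^ (T - 1 - i)) * b ^ (L - T) + B
  | 0, L, W, _, h => ⟨fun _ => 0, by simp, ⟨W, by simp⟩, W, pal_lt h, by simp⟩
  | T + 1, L, W, hT, h => by
    obtain ⟨M, rfl⟩ : ∃ M, L = M + 2 := ⟨L - 2, by omega⟩
    obtain ⟨c, X, hc, hX, rfl⟩ := mem_pal_add_two.1 h
    obtain ⟨f, hf, ⟨A, hA⟩, B, hB, hB'⟩ := exists_digits (T := T) (by omega) hX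
    refine ⟨fun i => if i = 0 then c else f (i - 1), ?_, ⟨A + c * b ^ (M - T), ?_⟩,
      c + b * B, ?_, ?_⟩
    · rintro (_ | i) hi
      · simpa using hc
      · simpa using hf i (by omega)
    · rw [sum_range_succ']
      simp only [Nat.add_eq_zero_iff, one_ne_zero, and_false, if_false, Nat.add_sub_cancel,
        if_true, pow_zero, mul_one]
      have : b ^ (M + 1) = b ^ (T + 1) * b ^ (M - T) := by
        rw [← pow_add]; congr 1; omega
      rw [this, show ∑ i ∈ range T, f i * b ^ (i + 1) = b * ∑ i ∈ range T, f i * b ^ i by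
        rw [mul_sum]; exact sum_congr rfl fun i _ => by ring]
      nth_rewrite 1 [hA]
      ring
    · rw [show M + 2 - (T + 1) = (M - T) + 1 by omega]
      exact inner_lt hc hB
    · rw [sum_range_succ']
      simp only [Nat.add_eq_zero_iff, one_ne_zero, and_false, if_false, Nat.add_sub_cancel,
        if_true, Nat.sub_zero]
      rw [show ∑ i ∈ range T, f i * b ^ (T - (i + 1)) = ∑ i ∈ range T, f i * b ^ (T - 1 - i) by
        refine sum_congr rfl fun i _ => ?_
        congr 2; omega]
      have e1 : b ^ (M + 1) = b ^ T * b ^ (M - T + 1) := by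
        rw [← pow_add]; congr 1; omega
      rw [show M + 2 - (T + 1) = (M - T) + 1 by omega, e1]
      nth_rewrite 1 [hB']
      ring

lemma eq_of_dvd_sub_of_sign {b : ℕ} {v w : ℤ} (hv : v ∈ Ioo (-(b : ℤ)) b)
    (hw : w ∈ Ioo (-(b : ℤ)) b) (h : (b : ℤ) ∣ v - w) (hs : v < 0 ↔ w < 0) : v = w := by
  rw [mem_Ioo] at hv hw
  by_contra hne
  have h1 : (b : ℤ) ≤ |v - w| := by
    have := Int.le_of_dvd (abs_pos.2 (sub_ne_zero.2 hne)) ((dvd_abs _ _).2 h)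
    exact this
  rcases le_or_gt 0 v with h0 | h0
  · have h2 : 0 ≤ w := by by_contra hc; exact absurd (hs.2 (not_le.1 hc)) (not_lt.2 h0)
    have : |v - w| < b := abs_lt.2 ⟨by linarith, by linarith⟩
    linarith
  · have h2 := hs.1 h0
    have : |v - w| < b := abs_lt.2 ⟨by linarith, by linarith⟩
    linarith

/-- Pairs of signed digits with prescribed value modulo `b ^ 2`. -/
noncomputable def signedPairs (b : ℕ) (R : ℤ) : Finset (ℤ × ℤ) :=
  (Ioo (-(b : ℤ)) b ×ˢ Ioo (-(b : ℤ)) b).filter fun p => (b : ℤ) ^ 2 ∣ p.1 + b * p.2 - R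

lemma card_signedPairs_le {b : ℕ} (hb : 2 ≤ b) (R : ℤ) : (signedPairs b R).card ≤ b ^ 2 - 1 := by
  rcases hb.eq_or_lt with rfl | hb3
  · have : signedPairs 2 R = signedPairs 2 (R % 4) := by
      unfold signedPairs
      refine filter_congr fun p _ => ?_
      have : (((2 : ℕ) : ℤ) ^ 2) = 4 := by norm_num
      rw [this]
      omega
    rw [this]
    have h1 := Int.emod_nonneg R (show (4 : ℤ) ≠ 0 by norm_num)
    have h2 := Int.emod_lt_of_pos R (show (0 : ℤ) < 4 by norm_num)
    generalize R % 4 = r at *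
    interval_cases r <;> decide
  · have h4 : (signedPairs b R).card ≤ (univ : Finset (Bool × Bool)).card := by
      refine card_le_card_of_injOn (fun p => (decide (p.1 < 0), decide (p.2 < 0)))
        (fun _ _ => mem_coe.2 (mem_univ _)) ?_
      rintro ⟨v, w⟩ h ⟨v', w'⟩ h' heq
      simp only [signedPairs, coe_filter, mem_product, Set.mem_ofPred_eq] at h h'
      simp only [Prod.mk.injEq, decide_eq_decide] at heq
      obtain ⟨⟨hv, hw⟩, k, hk⟩ := h
      obtain ⟨⟨hv', hw'⟩, k', hk'⟩ := h'
      have e1 : v = v' := eq_of_dvd_sub_of_sign hv hv'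
        ⟨b * (k - k') - (w - w'), by linear_combination hk - hk'⟩ heq.1
      subst e1
      have hb0 : (b : ℤ) ≠ 0 := by positivity
      have e2 : w = w' := eq_of_dvd_sub_of_sign hw hw'
        ⟨k - k', mul_left_cancel₀ hb0 (by linear_combination hk - hk')⟩ heq.2
      rw [e2]
    have : (univ : Finset (Bool × Bool)).card = 4 := rfl
    have : 3 ^ 2 ≤ b ^ 2 := Nat.pow_le_pow_left hb3 2
    omega

/-- The reversals of the signed digit strings of length `2 * t` representing a given residue
modulo `b ^ (2 * t)` take at most `(b ^ 2 - 1) ^ t` values. -/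
lemma exists_reversal_set {b : ℕ} (hb : 2 ≤ b) : ∀ (t : ℕ) (R : ℤ), ∃ S : Finset ℤ,
    S.card ≤ (b ^ 2 - 1) ^ t ∧ ∀ v : ℕ → ℤ, (∀ i < 2 * t, v i ∈ Ioo (-(b : ℤ)) b) →
      (b : ℤ) ^ (2 * t) ∣ ∑ i ∈ range (2 * t), v i * b ^ i - R →
      ∑ i ∈ range (2 * t), v i * b ^ (2 * t - 1 - i) ∈ S
  | 0, R => ⟨{0}, by simp, by simp⟩
  | t + 1, R => by
    choose S hS hS' using fun R => exists_reversal_set hb t R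
    classical
    refine ⟨(signedPairs b R).biUnion fun p =>
      (S ((R - p.1 - b * p.2) / b ^ 2)).image fun h =>
        (p.1 * b + p.2) * b ^ (2 * t) + h, ?_, ?_⟩
    · refine (card_biUnion_le_card_mul _ _ ((b ^ 2 - 1) ^ t) fun p _ =>
        card_image_le.trans (hS _)).trans ?_
      rw [pow_succ' (b ^ 2 - 1) t]
      exact Nat.mul_le_mul_right _ (card_signedPairs_le hb R)
    · intro v hv hdvd
      have hb0 : (b : ℤ) ^ 2 ≠ 0 := by positivity
      have e0 : 2 * (t + 1) = 2 * t + 1 + 1 := by ring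
      rw [e0] at hdvd ⊢
      rw [sum_range_succ', sum_range_succ'] at hdvd
      have e1 : ∑ k ∈ range (2 * t), v (k + 1 + 1) * (b : ℤ) ^ (k + 1 + 1) =
          b ^ 2 * ∑ k ∈ range (2 * t), v (k + 2) * (b : ℤ) ^ k := by
        rw [mul_sum]; exact sum_congr rfl fun i _ => by ring
      rw [e1] at hdvd
      obtain ⟨k, hk⟩ := hdvd
      have hR : R - v 0 - b * v 1 = b ^ 2 *
          (∑ k ∈ range (2 * t), v (k + 2) * (b : ℤ) ^ k - b ^ (2 * t) * k) := by
        linear_combination -hk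
      rw [mem_biUnion]
      refine ⟨(v 0, v 1), ?_, ?_⟩
      · simp only [signedPairs, mem_filter, mem_product]
        refine ⟨⟨hv 0 (by omega), hv 1 (by omega)⟩, ?_⟩
        refine ⟨-(∑ k ∈ range (2 * t), v (k + 2) * (b : ℤ) ^ k - b ^ (2 * t) * k), ?_⟩
        linear_combination -hR
      · rw [mem_image]
        refine ⟨∑ i ∈ range (2 * t), v (i + 2) * b ^ (2 * t - 1 - i),
          hS' _ (fun i => v (i + 2)) (fun i hi => hv (i + 2) (by omega)) ?_, ?_⟩
        · simp only [hR]
          rw [Int.mul_ediv_cancel_left _ hb0]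
          exact ⟨k, by ring⟩
        · rw [sum_range_succ', sum_range_succ']
          rw [show ∑ k ∈ range (2 * t), v (k + 1 + 1) * (b : ℤ) ^ (2 * t + 1 + 1 - 1 - (k + 1 + 1)) =
            ∑ i ∈ range (2 * t), v (i + 2) * (b : ℤ) ^ (2 * t - 1 - i) from
            sum_congr rfl fun i _ => by congr 2; omega]
          simp only [zero_add, Nat.add_sub_cancel, Nat.sub_zero]
          ring

/-- `V` is a difference of two palindromes of length `L`. -/
def IsPalDiff (b L : ℕ) (V : ℤ) : Prop :=
  ∃ W ∈ pal b L, ∃ W' ∈ pal b L, V = (W : ℤ) - W'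

lemma IsPalDiff.exists_signed_digits {b T L : ℕ} {V : ℤ} (hT : 2 * T ≤ L)
    (hV : IsPalDiff b L V) : ∃ v : ℕ → ℤ, (∀ i < T, v i ∈ Ioo (-(b : ℤ)) b) ∧
      (b : ℤ) ^ T ∣ ∑ i ∈ range T, v i * b ^ i - V ∧
      |V - (∑ i ∈ range T, v i * b ^ (T - 1 - i)) * b ^ (L - T)| < b ^ (L - T) := by
  obtain ⟨W, hW, W', hW', rfl⟩ := hV
  obtain ⟨c, hc, ⟨A, hA⟩, B, hB, hWB⟩ := exists_digits hT hW
  obtain ⟨c', hc', ⟨A', hA'⟩, B', hB', hWB'⟩ := exists_digits hT hW'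
  zify at hA hA' hWB hWB' hB hB'
  refine ⟨fun i => (c i : ℤ) - c' i, fun i hi => ?_, ⟨A' - A, ?_⟩, ?_⟩
  · have := hc i hi
    have := hc' i hi
    simp only [mem_Ioo]
    constructor <;> omega
  · rw [hA, hA']
    simp only [sub_mul, sum_sub_distrib]
    ring
  · rw [hWB, hWB']
    simp only [sub_mul, sum_sub_distrib]
    rw [abs_lt]
    have : (0 : ℤ) ≤ B := by positivity
    have : (0 : ℤ) ≤ B' := by positivity
    constructor <;> linarith

lemma card_le_of_mod_eq {M X r : ℕ} (S : Finset ℕ)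
    (hr : ∀ d ∈ S, d % M = r) (hX : ∀ d ∈ S, ∀ e ∈ S, e ≤ d → d - e < M * X) : S.card ≤ X := by
  rcases S.eq_empty_or_nonempty with rfl | hne
  · simp
  set m := S.min' hne
  have hm : m ∈ S := S.min'_mem hne
  have hle : ∀ d ∈ S, m ≤ d := fun d hd => S.min'_le d hd
  calc S.card ≤ (range X).card := by
        refine card_le_card_of_injOn (fun d => d / M - m / M) ?_ ?_
        · intro d hd
          rw [mem_coe] at hd
          simp only [coe_range, Set.mem_Iio]
          have h1 := hX d hd m hm (hle d hd)
          have h2 := Nat.div_add_mod d M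
          have h3 := Nat.div_add_mod m M
          rw [hr d hd] at h2
          rw [hr m hm] at h3
          have h4 : M * (d / M - m / M) < M * X := by rw [Nat.mul_sub]; omega
          exact Nat.lt_of_mul_lt_mul_left h4
        · intro d hd e he heq
          rw [mem_coe] at hd he
          simp only at heq
          have h1 := Nat.div_le_div_right (c := M) (hle d hd)
          have h2 := Nat.div_le_div_right (c := M) (hle e he)
          have h3 : d / M = e / M := by omega
          rw [← Nat.div_add_mod d M, ← Nat.div_add_mod e M, h3, hr d hd, hr e he]
    _ = X := card_range X

open Classical in
/-- For a fixed multiplier `m ≠ 0`, few `d` of size about `b ^ j` are such that `d ^ 2 * m` is a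
difference of palindromes. -/
lemma card_sq_mul_isPalDiff_le {b : ℕ} (hb : 2 ≤ b) {L j t : ℕ} (ht : 4 * t + j ≤ L)
    {m : ℤ} (hm : m ≠ 0) :
    ((Ico (b ^ j) (b ^ (j + 1))).filter fun d : ℕ => IsPalDiff b L ((d : ℤ) ^ 2 * m)).card ≤
      b ^ (2 * t) * ((b ^ 2 - 1) ^ t * b ^ (L - 4 * t - j)) := by
  choose S hS hS' using fun R => exists_reversal_set hb t R
  have hb0 : 0 < b := by omega
  let fib : ℕ → ℤ → Finset ℕ := fun r y => (Ico (b ^ j) (b ^ (j + 1))).filter fun d : ℕ =>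
    d % b ^ (2 * t) = r ∧ |(d : ℤ) ^ 2 * m - y * b ^ (L - 2 * t)| < b ^ (L - 2 * t)
  have hsub : ((Ico (b ^ j) (b ^ (j + 1))).filter fun d : ℕ => IsPalDiff b L ((d : ℤ) ^ 2 * m)) ⊆
      (range (b ^ (2 * t))).biUnion fun r => (S ((r : ℤ) ^ 2 * m)).biUnion fun y => fib r y := by
    intro d hd
    rw [mem_filter] at hd
    obtain ⟨v, hv, hv1, hv2⟩ := hd.2.exists_signed_digits (T := 2 * t) (by omega)
    rw [mem_biUnion]
    refine ⟨d % b ^ (2 * t), mem_range.2 (Nat.mod_lt _ (by positivity)), ?_⟩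
    rw [mem_biUnion]
    refine ⟨_, hS' _ v hv ?_, ?_⟩
    · have : (b : ℤ) ^ (2 * t) ∣ (d : ℤ) ^ 2 * m - ((d % b ^ (2 * t) : ℕ) : ℤ) ^ 2 * m := by
        rw [← sub_mul]
        apply Dvd.dvd.mul_right
        push_cast
        have h1 : (b : ℤ) ^ (2 * t) ∣ (d : ℤ) - (d : ℤ) % b ^ (2 * t) :=
          Int.dvd_self_sub_emod
        rw [sq_sub_sq]
        exact h1.mul_left _
      have h2 := dvd_add hv1 this
      rwa [sub_add_sub_cancel] at h2
    · exact mem_filter.2 ⟨hd.1, rfl, hv2⟩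
  have hfib : ∀ r y, (fib r y).card ≤ b ^ (L - 4 * t - j) := by
    intro r y
    refine card_le_of_mod_eq (M := b ^ (2 * t)) (r := r) _
      (fun d hd => (mem_filter.1 hd).2.1) ?_
    intro d hd e he hed
    obtain ⟨hd1, -, hd2⟩ := mem_filter.1 hd
    obtain ⟨he1, -, he2⟩ := mem_filter.1 he
    rw [mem_Ico] at hd1 he1
    rw [← pow_add, show 2 * t + (L - 4 * t - j) = L - 2 * t - j by omega]
    have h1 : |((d : ℤ) ^ 2 - (e : ℤ) ^ 2) * m| < 2 * b ^ (L - 2 * t) := by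
      rw [abs_lt] at hd2 he2 ⊢
      constructor <;> nlinarith
    have h2 : ((d : ℤ) ^ 2 - (e : ℤ) ^ 2) ≤ |((d : ℤ) ^ 2 - (e : ℤ) ^ 2) * m| := by
      rw [abs_mul]
      have : 1 ≤ |m| := Int.one_le_abs hm
      calc ((d : ℤ) ^ 2 - (e : ℤ) ^ 2) ≤ |((d : ℤ) ^ 2 - (e : ℤ) ^ 2)| := le_abs_self _
        _ ≤ _ := le_mul_of_one_le_right (abs_nonneg _) this
    have h3 : (L - 2 * t) = (L - 2 * t - j) + j := by omega
    rw [h3, pow_add] at h1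
    have h4 : (b : ℤ) ^ j ≤ d := by exact_mod_cast hd1.1
    have h5 : (b : ℤ) ^ j ≤ e := by exact_mod_cast he1.1
    have h6 : (e : ℤ) ≤ d := by exact_mod_cast hed
    by_contra hcon
    have h7 : (b : ℤ) ^ (L - 2 * t - j) ≤ (d : ℤ) - e := by
      have : b ^ (L - 2 * t - j) ≤ d - e := not_lt.1 hcon
      zify [hed] at this
      exact this
    have h8 : (b : ℤ) ^ (L - 2 * t - j) * (2 * b ^ j) ≤ ((d : ℤ) - e) * (d + e) := by
      apply mul_le_mul h7 (by linarith) (by positivity) (by linarith)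
    nlinarith
  refine (card_le_card hsub).trans ?_
  refine (card_biUnion_le_card_mul _ _ ((b ^ 2 - 1) ^ t * b ^ (L - 4 * t - j)) fun r _ => ?_).trans
    (by rw [card_range])
  exact (card_biUnion_le_card_mul _ _ _ fun y _ => hfib r y).trans
    (Nat.mul_le_mul_right _ (hS _))
/-- Nonzero palindromes of length `N` divisible by `d ^ 2`. -/
def palSq (b N d : ℕ) : Finset ℕ := (pal b N).filter fun n => n ≠ 0 ∧ d ^ 2 ∣ n

/-- Integers of size about `b ^ j` coprime to `b`. -/
def dyad (b j : ℕ) : Finset ℕ := (Ico (b ^ j) (b ^ (j + 1))).filter fun d => d.Coprime b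

lemma card_dyad_le (b j : ℕ) : (dyad b j).card ≤ b ^ (j + 1) := by
  refine (card_filter_le _ _).trans ?_
  rw [Nat.card_Ico]
  omega

lemma exists_sq_mul_of_prefix_eq {b N s d n n' : ℕ} (hs : 2 * s ≤ N)
    (hd : d.Coprime b) (h : n ∈ palSq b N d) (h' : n' ∈ palSq b N d)
    (heq : n / b ^ (N - s) = n' / b ^ (N - s)) :
    ∃ m : ℤ, (n : ℤ) - n' = b ^ s * (d ^ 2 * m) ∧ IsPalDiff b (N - 2 * s) (d ^ 2 * m) ∧
      |(d : ℤ) ^ 2 * m| < b ^ (N - 2 * s) := by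
  obtain ⟨hn, -, hdn⟩ := mem_filter.1 h
  obtain ⟨hn', -, hdn'⟩ := mem_filter.1 h'
  obtain ⟨W, hW, W', hW', hWW⟩ := sub_eq_of_prefix_eq hs hn hn' heq
  have h1 : ((d : ℤ) ^ 2) ∣ b ^ s * ((W : ℤ) - W') := by
    rw [← hWW]
    exact dvd_sub (by exact_mod_cast hdn) (by exact_mod_cast hdn')
  have h2 : IsCoprime ((d : ℤ) ^ 2) (b ^ s) :=
    IsCoprime.pow (Nat.isCoprime_iff_coprime.2 hd)
  obtain ⟨m, hm⟩ := h2.dvd_of_dvd_mul_left h1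
  refine ⟨m, by rw [hWW, hm], ⟨W, hW, W', hW', hm.symm⟩, ?_⟩
  rw [← hm, abs_lt]
  have h3 : (W : ℤ) < b ^ (N - 2 * s) := by exact_mod_cast pal_lt hW
  have h4 : (W' : ℤ) < b ^ (N - 2 * s) := by exact_mod_cast pal_lt hW'
  constructor <;> linarith [Int.natCast_nonneg W, Int.natCast_nonneg W']

lemma card_palSq_le {b N s j d : ℕ} (hb : 2 ≤ b) (hs : 2 * s ≤ N) (hj : N - 2 * s ≤ 2 * j)
    (hd : d ∈ dyad b j) : (palSq b N d).card ≤ b ^ s := by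
  obtain ⟨hd1, hdc⟩ := mem_filter.1 hd
  rw [mem_Ico] at hd1
  have hb0 : 0 < b := by omega
  rw [← card_range (b ^ s)]
  refine card_le_card_of_injOn (fun n => n / b ^ (N - s)) ?_ ?_
  · intro n hn
    have h1 := pal_lt (mem_filter.1 (mem_coe.1 hn)).1
    simp only [coe_range, Set.mem_Iio]
    rw [Nat.div_lt_iff_lt_mul (by positivity), ← pow_add, show s + (N - s) = N by omega]
    exact h1
  · intro n hn n' hn' heq
    obtain ⟨m, hm, -, hlt⟩ := exists_sq_mul_of_prefix_eq hs hdc hn hn' heq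
    have h2 : (b : ℤ) ^ (N - 2 * s) ≤ (d : ℤ) ^ 2 := by
      have : b ^ (N - 2 * s) ≤ d ^ 2 := by
        calc b ^ (N - 2 * s) ≤ b ^ (2 * j) := Nat.pow_le_pow_right hb0 hj
          _ = (b ^ j) ^ 2 := by rw [← pow_mul, mul_comm]
          _ ≤ d ^ 2 := Nat.pow_le_pow_left hd1.1 2
      exact_mod_cast this
    have hm0 : m = 0 := by
      by_contra hne
      have := Int.one_le_abs hne
      rw [abs_mul, abs_of_nonneg (by positivity : (0 : ℤ) ≤ (d : ℤ) ^ 2)] at hlt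
      nlinarith
    rw [hm0] at hm
    simp only [mul_zero, sub_eq_zero] at hm
    exact_mod_cast hm

open Classical in
lemma sum_card_isPalDiff_le {b : ℕ} (hb : 2 ≤ b) {L j t : ℕ} (ht : 4 * t + j ≤ L) (B : ℕ) :
    ∑ d ∈ dyad b j, ((Ioo (-(B : ℤ)) B).filter fun m => m ≠ 0 ∧
      IsPalDiff b L ((d : ℤ) ^ 2 * m)).card ≤
      2 * B * (b ^ (2 * t) * ((b ^ 2 - 1) ^ t * b ^ (L - 4 * t - j))) := by
  have h := sum_card_bipartiteAbove_eq_sum_card_bipartiteBelow (s := dyad b j)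
    (t := Ioo (-(B : ℤ)) B) (fun (d : ℕ) (m : ℤ) => m ≠ 0 ∧ IsPalDiff b L ((d : ℤ) ^ 2 * m))
  simp only [bipartiteAbove, bipartiteBelow] at h
  rw [h]
  refine (sum_le_card_nsmul _ _ (b ^ (2 * t) * ((b ^ 2 - 1) ^ t * b ^ (L - 4 * t - j)))
    fun m _ => ?_).trans ?_
  · rcases eq_or_ne m 0 with rfl | hm
    · simp
    · refine (card_le_card ?_).trans (card_sq_mul_isPalDiff_le hb ht hm)
      intro d hd
      simp only [dyad, mem_filter] at hd ⊢
      exact ⟨hd.1.1, hd.2.2⟩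
  · rw [smul_eq_mul]
    refine Nat.mul_le_mul_right _ ?_
    rw [Int.card_Ioo]
    omega

lemma abs_lt_of_sq_mul {b L j d : ℕ} {m : ℤ} (hL : 2 * j ≤ L) (hb : 2 ≤ b) (hd : b ^ j ≤ d)
    (h : |(d : ℤ) ^ 2 * m| < b ^ L) :
    m ∈ Ioo (-((b ^ (L - 2 * j) : ℕ) : ℤ)) (b ^ (L - 2 * j) : ℕ) := by
  rw [mem_Ioo, ← abs_lt]
  rw [abs_mul, abs_of_nonneg (by positivity : (0 : ℤ) ≤ (d : ℤ) ^ 2)] at h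
  have h1 : (b : ℤ) ^ (2 * j) ≤ (d : ℤ) ^ 2 := by
    rw [mul_comm, pow_mul]
    exact pow_le_pow_left₀ (by positivity) (by exact_mod_cast hd) 2
  have h2 : (b : ℤ) ^ L = b ^ (2 * j) * b ^ (L - 2 * j) := by
    rw [← pow_add]; congr 1; omega
  have h3 : (b : ℤ) ^ (2 * j) * |m| < b ^ (2 * j) * b ^ (L - 2 * j) := by
    rw [← h2]
    exact (mul_le_mul_of_nonneg_right h1 (abs_nonneg _)).trans_lt h
  push_cast
  exact lt_of_mul_lt_mul_left h3 (by positivity)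

/-- Direct estimate for the number of palindromes with a large square divisor. -/
lemma sum_card_palSq_le {b N j t : ℕ} (hb : 2 ≤ b) (ht : 4 * t + j ≤ N) :
    ∑ d ∈ dyad b j, (palSq b N d).card ≤
      2 * b ^ (N - 2 * j) * (b ^ (2 * t) * ((b ^ 2 - 1) ^ t * b ^ (N - 4 * t - j))) := by
  classical
  refine (sum_le_sum fun d hd => ?_).trans (sum_card_isPalDiff_le hb ht (b ^ (N - 2 * j)))
  obtain ⟨hd1, hdc⟩ := mem_filter.1 hd
  rw [mem_Ico] at hd1
  have hd0 : 0 < d := lt_of_lt_of_le (by positivity) hd1.1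
  refine card_le_card_of_injOn (fun n => ((n / d ^ 2 : ℕ) : ℤ)) ?_ ?_
  · intro n hn
    obtain ⟨h1, h2, m, rfl⟩ := mem_filter.1 (mem_coe.1 hn)
    simp only [Nat.mul_div_cancel_left m (show 0 < d ^ 2 by positivity)]
    have hlt := pal_lt h1
    have hm : m ≠ 0 := by rintro rfl; simp at h2
    have hN : 2 * j ≤ N := by
      by_contra hcon
      have h3 : b ^ N ≤ b ^ (2 * j) := Nat.pow_le_pow_right (by omega) (by omega)
      have h4 : b ^ (2 * j) ≤ d ^ 2 := by
        rw [mul_comm, pow_mul]; exact Nat.pow_le_pow_left hd1.1 2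
      have : d ^ 2 * 1 ≤ d ^ 2 * m := Nat.mul_le_mul_left _ (by omega)
      omega
    rw [mem_coe, mem_filter]
    refine ⟨abs_lt_of_sq_mul hN hb hd1.1 ?_, by exact_mod_cast hm, d ^ 2 * m, h1, 0,
      zero_mem_pal hb N, by push_cast; ring⟩
    rw [abs_of_nonneg (by positivity)]
    exact_mod_cast hlt
  · intro n hn n' hn' heq
    have h1 := (mem_filter.1 (mem_coe.1 hn)).2.2
    have h2 := (mem_filter.1 (mem_coe.1 hn')).2.2
    simp only [Nat.cast_inj] at heq
    rw [← Nat.mul_div_cancel' h1, ← Nat.mul_div_cancel' h2, heq]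

/-- Estimate for the number of palindromes with a large square divisor, via pairs of palindromes
with a common prefix. -/
lemma sq_sum_card_palSq_le {b N j t s s' : ℕ} (hb : 2 ≤ b) (hs : s ≤ s') (hs' : 2 * s' ≤ N)
    (hj : N - 2 * s' ≤ 2 * j) (hL : 2 * j ≤ N - 2 * s) (ht : 4 * t + j ≤ N - 2 * s) :
    (∑ d ∈ dyad b j, (palSq b N d).card) ^ 2 ≤ b ^ (j + 1) * (b ^ s * (b ^ s' * (b ^ (j + 1) +
      2 * b ^ (N - 2 * s - 2 * j) *
        (b ^ (2 * t) * ((b ^ 2 - 1) ^ t * b ^ (N - 2 * s - 4 * t - j)))))) := by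
  classical
  set L := N - 2 * s with hLdef
  set B := b ^ (L - 2 * j) with hB
  set g : ℕ → ℕ := fun d => ((Ioo (-(B : ℤ)) B).filter fun m => m ≠ 0 ∧
      IsPalDiff b L ((d : ℤ) ^ 2 * m)).card with hg
  have hfib : ∀ d ∈ dyad b j, ∀ u, ((palSq b N d).filter fun n => n / b ^ (N - s) = u).card ≤
      1 + g d := by
    intro d hd u
    obtain ⟨hd1, hdc⟩ := mem_filter.1 hd
    rw [mem_Ico] at hd1
    rcases ((palSq b N d).filter fun n => n / b ^ (N - s) = u).eq_empty_or_nonempty with h0 | ⟨n, hn⟩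
    · rw [h0]; simp
    · rw [mem_filter] at hn
      have hex : ∀ n' : ℕ, ∃ m : ℤ, n' ∈ palSq b N d → n' / b ^ (N - s) = u →
          (n : ℤ) - n' = b ^ s * (d ^ 2 * m) ∧ IsPalDiff b L (d ^ 2 * m) ∧
          |(d : ℤ) ^ 2 * m| < b ^ L := by
        intro n'
        by_cases h : n' ∈ palSq b N d ∧ n' / b ^ (N - s) = u
        · obtain ⟨m, hm⟩ := exists_sq_mul_of_prefix_eq (by omega) hdc hn.1 h.1
            (hn.2.trans h.2.symm)
          exact ⟨m, fun _ _ => hm⟩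
        · exact ⟨0, fun h1 h2 => absurd ⟨h1, h2⟩ h⟩
      choose f hf using hex
      refine (card_le_card_of_injOn (t := insert 0 ((Ioo (-(B : ℤ)) B).filter fun m => m ≠ 0 ∧
        IsPalDiff b L ((d : ℤ) ^ 2 * m))) f ?_ ?_).trans
          ((card_insert_le _ _).trans (by rw [add_comm]))
      · intro n' hn'
        obtain ⟨h1, h2⟩ := mem_filter.1 (mem_coe.1 hn')
        obtain ⟨-, h3, h4⟩ := hf n' h1 h2
        rw [mem_coe, mem_insert, mem_filter]
        by_cases h : f n' = 0
        · exact Or.inl h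
        · exact Or.inr ⟨abs_lt_of_sq_mul hL hb hd1.1 h4, h, h3⟩
      · intro n₁ hn₁ n₂ hn₂ heq
        obtain ⟨h1, h2⟩ := mem_filter.1 (mem_coe.1 hn₁)
        obtain ⟨h3, h4⟩ := mem_filter.1 (mem_coe.1 hn₂)
        have e1 := (hf n₁ h1 h2).1
        have e2 := (hf n₂ h3 h4).1
        rw [heq] at e1
        have : (n₁ : ℤ) = n₂ := by linarith
        exact_mod_cast this
  have hb0 : 0 < b := by omega
  have hone : ∀ d ∈ dyad b j, (palSq b N d).card ^ 2 ≤ b ^ s * (b ^ s' * (1 + g d)) := by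
    intro d hd
    have hmaps : ∀ n ∈ palSq b N d, n / b ^ (N - s) ∈ range (b ^ s) := by
      intro n hn
      rw [mem_range, Nat.div_lt_iff_lt_mul (by positivity), ← pow_add,
        show s + (N - s) = N by omega]
      exact pal_lt (mem_filter.1 hn).1
    have h1 := card_eq_sum_card_fiberwise hmaps
    calc (palSq b N d).card ^ 2
        = (∑ u ∈ range (b ^ s), ((palSq b N d).filter fun n => n / b ^ (N - s) = u).card) ^ 2 := by
          rw [← h1]
      _ ≤ (range (b ^ s)).card * ∑ u ∈ range (b ^ s),
            ((palSq b N d).filter fun n => n / b ^ (N - s) = u).card ^ 2 :=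
          sq_sum_le_card_mul_sum_sq
      _ ≤ b ^ s * ∑ u ∈ range (b ^ s),
            ((palSq b N d).filter fun n => n / b ^ (N - s) = u).card * (1 + g d) := by
          rw [card_range]
          refine Nat.mul_le_mul_left _ (sum_le_sum fun u _ => ?_)
          rw [sq]
          exact Nat.mul_le_mul_left _ (hfib d hd u)
      _ = b ^ s * ((palSq b N d).card * (1 + g d)) := by rw [← sum_mul, ← h1]
      _ ≤ _ := Nat.mul_le_mul_left _ (Nat.mul_le_mul_right _ (card_palSq_le hb hs' hj hd))
  calc (∑ d ∈ dyad b j, (palSq b N d).card) ^ 2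
      ≤ (dyad b j).card * ∑ d ∈ dyad b j, (palSq b N d).card ^ 2 := sq_sum_le_card_mul_sum_sq
    _ ≤ b ^ (j + 1) * ∑ d ∈ dyad b j, b ^ s * (b ^ s' * (1 + g d)) :=
        Nat.mul_le_mul (card_dyad_le b j) (sum_le_sum hone)
    _ = b ^ (j + 1) * (b ^ s * (b ^ s' * ((dyad b j).card + ∑ d ∈ dyad b j, g d))) := by
        rw [← mul_sum, ← mul_sum, sum_add_distrib, card_eq_sum_ones]
    _ ≤ _ := by
        gcongr
        · exact card_dyad_le b j
        · exact sum_card_isPalDiff_le hb ht B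
lemma palSq_eq_empty {b N j d : ℕ} (hb : 2 ≤ b) (hN : N ≤ 2 * j) (hd : b ^ j ≤ d) :
    palSq b N d = ∅ := by
  refine filter_eq_empty_iff.2 fun n hn h => ?_
  have h1 := pal_lt hn
  have h2 := Nat.le_of_dvd (Nat.pos_of_ne_zero h.1) h.2
  have h3 : b ^ N ≤ b ^ (2 * j) := Nat.pow_le_pow_right (by omega) hN
  have h4 : b ^ (2 * j) ≤ d ^ 2 := by
    rw [mul_comm, pow_mul]; exact Nat.pow_le_pow_left hd 2
  omega

lemma exists_pow_sq_sub_one_le {b : ℕ} (hb : 2 ≤ b) :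
    ∃ H, 2 ≤ H ∧ (b ^ 2 - 1) ^ H ≤ b ^ (2 * H - 4) := by
  have hb0 : (0 : ℝ) < b := by positivity
  have h1 : (1 : ℝ) - 1 / b ^ 2 < 1 := by
    have : (0 : ℝ) < 1 / b ^ 2 := by positivity
    linarith
  obtain ⟨H, hH⟩ := exists_pow_lt_of_lt_one (show (0 : ℝ) < 1 / b ^ 4 by positivity) h1
  have hb2 : (2 : ℝ) ≤ b := by exact_mod_cast hb
  have hb4 : (4 : ℝ) ≤ b ^ 2 := by nlinarith
  have h0 : (0 : ℝ) ≤ 1 - 1 / b ^ 2 := by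
    rw [sub_nonneg, div_le_one (by positivity)]
    linarith
  refine ⟨H + 2, by omega, ?_⟩
  have h2 : (1 - 1 / (b : ℝ) ^ 2) ^ (H + 2) ≤ 1 / b ^ 4 := by
    refine (pow_le_pow_of_le_one h0 h1.le (by omega)).trans hH.le
  have h3 : ((b ^ 2 - 1 : ℕ) : ℝ) = b ^ 2 * (1 - 1 / b ^ 2) := by
    rw [Nat.cast_sub (Nat.one_le_pow _ _ (by omega))]
    push_cast
    field_simp
  have h4 : (((b ^ 2 - 1) ^ (H + 2) : ℕ) : ℝ) ≤ ((b ^ (2 * (H + 2) - 4) : ℕ) : ℝ) := by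
    rw [Nat.cast_pow, h3, mul_pow, show 2 * (H + 2) - 4 = 2 * H by omega]
    push_cast
    calc ((b : ℝ) ^ 2) ^ (H + 2) * (1 - 1 / b ^ 2) ^ (H + 2)
        ≤ ((b : ℝ) ^ 2) ^ (H + 2) * (1 / b ^ 4) := by gcongr
      _ = (b : ℝ) ^ (2 * H) := by
        rw [← pow_mul, show 2 * (H + 2) = 2 * H + 4 by ring, pow_add]
        field_simp
  exact_mod_cast h4

lemma exists_sq_sum_card_palSq_mul_le {b : ℕ} (hb : 2 ≤ b) : ∃ H K, 1 ≤ H ∧ ∀ N j,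
    (∑ d ∈ dyad b j, (palSq b N d).card) ^ 2 * b ^ (j / H) ≤ K * b ^ N := by
  obtain ⟨H, hH2, hH⟩ := exists_pow_sq_sub_one_le hb
  have hb0 : 0 < b := by omega
  refine ⟨4 * H, 4 * b ^ (8 * H + 3), by omega, fun N j => ?_⟩
  set ℓ := j / (4 * H) with hℓ
  set T := ∑ d ∈ dyad b j, (palSq b N d).card with hT
  set t := H * ℓ with ht
  have htj : 4 * t ≤ j := by
    have := Nat.mul_div_le j (4 * H)
    rw [ht, ← mul_assoc]
    exact this
  have hX : (b ^ 2 - 1) ^ t ≤ b ^ (2 * t - 4 * ℓ) := by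
    rw [ht, pow_mul, show 2 * (H * ℓ) - 4 * ℓ = (2 * H - 4) * ℓ by rw [Nat.sub_mul]; ring_nf, pow_mul]
    exact Nat.pow_le_pow_left hH _
  have htl : 4 * ℓ ≤ 2 * t := by
    have := Nat.mul_le_mul_right ℓ hH2
    omega
  have hfin : ∀ a, a ≤ N + 3 → b ^ a ≤ b ^ (8 * H + 3) * b ^ N := by
    intro a ha
    rw [← pow_add]
    exact Nat.pow_le_pow_right hb0 (by omega)
  rcases Nat.eq_zero_or_pos ℓ with h0 | h0
  · have hj : j < 4 * H := by
      by_contra hcon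
      have := Nat.div_pos (not_lt.1 hcon) (by omega)
      omega
    have h1 : T ≤ b ^ (j + 1) * b ^ ((N + 1) / 2) := by
      calc T ≤ (dyad b j).card • b ^ ((N + 1) / 2) :=
            sum_le_card_nsmul _ _ _ fun d _ => (card_filter_le _ _).trans (card_pal_le b N)
        _ ≤ _ := Nat.mul_le_mul_right _ (card_dyad_le b j)
    rw [h0, pow_zero, mul_one]
    calc T ^ 2 ≤ (b ^ (j + 1) * b ^ ((N + 1) / 2)) ^ 2 := Nat.pow_le_pow_left h1 2
      _ = b ^ (2 * (j + 1) + 2 * ((N + 1) / 2)) := by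
        rw [← pow_add, ← pow_mul]; congr 1; ring
      _ ≤ b ^ (8 * H + 3 + N) := Nat.pow_le_pow_right hb0 (by omega)
      _ = 1 * b ^ (8 * H + 3) * b ^ N := by rw [pow_add, one_mul]
      _ ≤ _ := by gcongr; norm_num
  · rcases le_or_gt (j + ℓ) ((N + 1) / 2) with h1 | h1
    · have h2 := sq_sum_card_palSq_le (b := b) (N := N) (j := j) (t := t)
        (s := (N + 1) / 2 - j - ℓ) (s' := (N + 1) / 2 - j) hb (by omega) (by omega) (by omega)
        (by omega) (by omega)
      rw [← hT] at h2
      set s' := (N + 1) / 2 - j with hs'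
      set L := N - 2 * (s' - ℓ) with hL
      calc T ^ 2 * b ^ ℓ ≤ b ^ (j + 1) * (b ^ (s' - ℓ) * (b ^ s' * (b ^ (j + 1) +
            2 * b ^ (L - 2 * j) * (b ^ (2 * t) * (b ^ (2 * t - 4 * ℓ) * b ^ (L - 4 * t - j)))))) *
              b ^ ℓ := by
            refine Nat.mul_le_mul_right _ (h2.trans ?_)
            gcongr
        _ = b ^ ((j + 1) + (s' - ℓ) + s' + (j + 1) + ℓ) + 2 * b ^ ((j + 1) + (s' - ℓ) + s' +
            (L - 2 * j) + 2 * t + (2 * t - 4 * ℓ) + (L - 4 * t - j) + ℓ) := by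
            simp only [pow_add]; ring
        _ ≤ b ^ (8 * H + 3) * b ^ N + 2 * (b ^ (8 * H + 3) * b ^ N) := by
            gcongr
            · exact hfin _ (by omega)
            · exact hfin _ (by omega)
        _ ≤ _ := by rw [mul_assoc]; omega
    · rcases le_or_gt N (2 * j) with h2 | h2
      · have : T = 0 := by
          refine sum_eq_zero fun d hd => ?_
          rw [palSq_eq_empty hb h2 (mem_Ico.1 (mem_filter.1 hd).1).1, card_empty]
        rw [this]
        simp
      · have h3 := sum_card_palSq_le (b := b) (N := N) (j := j) (t := t) hb (by omega)
        rw [← hT] at h3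
        calc T ^ 2 * b ^ ℓ ≤ (2 * b ^ (N - 2 * j) * (b ^ (2 * t) * (b ^ (2 * t - 4 * ℓ) *
              b ^ (N - 4 * t - j)))) ^ 2 * b ^ ℓ := by
              refine Nat.mul_le_mul_right _ (Nat.pow_le_pow_left (h3.trans ?_) 2)
              gcongr
          _ = 4 * b ^ (2 * ((N - 2 * j) + 2 * t + (2 * t - 4 * ℓ) + (N - 4 * t - j)) + ℓ) := by
              rw [pow_add, Nat.mul_comm 2 (_ + _), pow_mul b _ 2]
              rw [pow_add b (_ + _ + _), pow_add b (_ + _), pow_add b (N - 2 * j)]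
              ring
          _ ≤ 4 * (b ^ (8 * H + 3) * b ^ N) := Nat.mul_le_mul_left _ (hfin _ (by omega))
          _ = _ := by rw [mul_assoc]

lemma exists_sum_card_palSq_le_geometric {b : ℕ} (hb : 2 ≤ b) : ∃ C κ : ℝ, 0 < C ∧ 0 < κ ∧ κ < 1 ∧
    ∀ N j, ((∑ d ∈ dyad b j, (palSq b N d).card : ℕ) : ℝ) ≤ C * √b ^ N * κ ^ j := by
  obtain ⟨H, K, hH, hK⟩ := exists_sq_sum_card_palSq_mul_le hb
  have hb2 : (2 : ℝ) ≤ b := by exact_mod_cast hb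
  have hb0 : (0 : ℝ) < b := by linarith
  set κ : ℝ := ((b : ℝ)⁻¹) ^ (((2 * H : ℕ) : ℝ)⁻¹) with hκ
  have hκ0 : 0 < κ := Real.rpow_pos_of_pos (by positivity) _
  have hκ1 : κ < 1 := Real.rpow_lt_one (by positivity) (inv_lt_one_of_one_lt₀ (by linarith))
    (by positivity)
  have hκH : κ ^ (2 * H) = (b : ℝ)⁻¹ := Real.rpow_inv_natCast_pow (by positivity) (by omega)
  refine ⟨K * b + 1, κ, by positivity, hκ0, hκ1, fun N j => ?_⟩
  set T := ∑ d ∈ dyad b j, (palSq b N d).card with hT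
  have h1 : (T : ℝ) ^ 2 * b ^ (j / H) ≤ K * b ^ N := by exact_mod_cast hK N j
  have h2 : ((b : ℝ)⁻¹) ^ (j / H + 1) ≤ κ ^ (2 * j) := by
    rw [← hκH, ← pow_mul]
    refine pow_le_pow_of_le_one hκ0.le hκ1.le ?_
    have := Nat.lt_mul_div_succ j (show 0 < H by omega)
    rw [mul_assoc]
    omega
  have h3 : (T : ℝ) ^ 2 ≤ (K * b) * (b ^ N * κ ^ (2 * j)) := by
    calc (T : ℝ) ^ 2 = (T ^ 2 * b ^ (j / H)) * b * ((b : ℝ)⁻¹) ^ (j / H + 1) := by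
          rw [inv_pow, pow_succ]
          field_simp
          rw [pow_succ]; ring
      _ ≤ (K * b ^ N) * b * κ ^ (2 * j) := by gcongr
      _ = _ := by ring
  have h4 : (√(b : ℝ) ^ N) ^ 2 = b ^ N := by
    rw [← pow_mul, mul_comm, pow_mul, Real.sq_sqrt hb0.le]
  refine abs_le_of_sq_le_sq' ?_ (by positivity) |>.2
  have h5 : (0 : ℝ) ≤ K * b := by positivity
  calc (T : ℝ) ^ 2 ≤ (K * b) * (b ^ N * κ ^ (2 * j)) := h3
    _ ≤ (K * b + 1) ^ 2 * (b ^ N * κ ^ (2 * j)) := by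
        gcongr; nlinarith
    _ = _ := by rw [← h4]; ring

/-- Few palindromes with at most `N` digits have a large square divisor coprime to the base. -/
lemma exists_sum_sum_card_palSq_le {b : ℕ} (hb : 2 ≤ b) : ∃ C κ : ℝ, 0 < C ∧ 0 < κ ∧ κ < 1 ∧
    ∀ N j J, ∑ M ∈ range (N + 1), ∑ d ∈ (Ico (b ^ j) (b ^ J)).filter (fun d => d.Coprime b),
      ((palSq b M d).card : ℝ) ≤ C * √b ^ N * κ ^ j := by
  obtain ⟨C, κ, hC, hκ0, hκ1, hT⟩ := exists_sum_card_palSq_le_geometric hb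
  have hb2 : (2 : ℝ) ≤ b := by exact_mod_cast hb
  have hβ : 1 < √(b : ℝ) := by rw [Real.lt_sqrt (by norm_num)]; linarith
  have hb0 : 0 < b := by omega
  have hone : ∀ M j i, ∑ d ∈ (Ico (b ^ j) (b ^ (j + i))).filter (fun d => d.Coprime b),
      ((palSq b M d).card : ℝ) ≤ C * √b ^ M * ∑ k ∈ Ico j (j + i), κ ^ k := by
    intro M j i
    induction i with
    | zero => simp
    | succ i ih =>
      rw [← add_assoc, ← Ico_union_Ico_eq_Ico (Nat.pow_le_pow_right hb0 (Nat.le_add_right j i))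
        (Nat.pow_le_pow_right hb0 (Nat.le_succ (j + i))), filter_union,
        sum_union (disjoint_filter_filter (Ico_disjoint_Ico_consecutive _ _ _)),
        sum_Ico_succ_top (Nat.le_add_right j i), mul_add]
      refine add_le_add ih ?_
      have := hT M (j + i)
      push_cast at this
      exact this
  have hκ : 0 < 1 - κ := by linarith
  refine ⟨C / (1 - κ) * (√b / (√b - 1)), κ, by
    have : 0 < √(b : ℝ) - 1 := by linarith
    positivity, hκ0, hκ1, fun N j J => ?_⟩
  have htwo : ∀ M, ∑ d ∈ (Ico (b ^ j) (b ^ J)).filter (fun d => d.Coprime b),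
      ((palSq b M d).card : ℝ) ≤ C / (1 - κ) * κ ^ j * √b ^ M := by
    intro M
    rcases le_or_gt j J with hjJ | hjJ
    · obtain ⟨i, rfl⟩ := Nat.exists_eq_add_of_le hjJ
      refine (hone M j i).trans ?_
      have : ∑ k ∈ Ico j (j + i), κ ^ k ≤ κ ^ j / (1 - κ) := by
        rw [sum_Ico_eq_sum_range, Nat.add_sub_cancel_left]
        simp only [pow_add]
        rw [← mul_sum, div_eq_mul_inv]
        refine mul_le_mul_of_nonneg_left ?_ (by positivity)
        rw [geom_sum_eq hκ1.ne, ← neg_div_neg_eq, neg_sub, neg_sub, ← one_div]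
        gcongr
        have := pow_pos hκ0 i
        linarith
      calc C * √b ^ M * ∑ k ∈ Ico j (j + i), κ ^ k ≤ C * √b ^ M * (κ ^ j / (1 - κ)) := by gcongr
        _ = _ := by ring
    · rw [Ico_eq_empty_of_le (Nat.pow_le_pow_right hb0 hjJ.le)]
      simp only [filter_empty, sum_empty]
      positivity
  refine (sum_le_sum fun M _ => htwo M).trans ?_
  rw [← mul_sum, geom_sum_eq hβ.ne']
  have h0 : 0 < √(b : ℝ) - 1 := by linarith
  calc C / (1 - κ) * κ ^ j * ((√b ^ (N + 1) - 1) / (√b - 1))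
      ≤ C / (1 - κ) * κ ^ j * ((√b ^ (N + 1)) / (√b - 1)) := by
        gcongr; linarith
    _ = _ := by rw [pow_succ]; ring
/-- Exponential sum over the palindromes of length `N`. -/
noncomputable def palSum (b N : ℕ) (z : ℂ) : ℂ := ∑ n ∈ pal b N, z ^ n

lemma palSum_add_two (b N : ℕ) (z : ℂ) :
    palSum b (N + 2) z = (∑ c ∈ range b, (z ^ (b ^ (N + 1) + 1)) ^ c) * palSum b N (z ^ b) := by
  rw [palSum, sum_pal_add_two, palSum, sum_mul]
  refine sum_congr rfl fun c _ => ?_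
  rw [mul_sum]
  refine sum_congr rfl fun W _ => ?_
  rw [pow_add, ← pow_mul, ← pow_mul, mul_comm c]

lemma norm_pow_sub_one_le {u : ℂ} (hu : ‖u‖ = 1) (n : ℕ) : ‖u ^ n - 1‖ ≤ n * ‖u - 1‖ := by
  induction n with
  | zero => simp
  | succ n ih =>
    have : u ^ (n + 1) - 1 = u ^ n * (u - 1) + (u ^ n - 1) := by ring
    rw [this]
    refine (norm_add_le _ _).trans ?_
    rw [norm_mul, norm_pow, hu, one_pow, one_mul]
    push_cast
    linarith

lemma norm_sum_pow_le_card {u : ℂ} (hu : ‖u‖ = 1) (b : ℕ) : ‖∑ c ∈ range b, u ^ c‖ ≤ b := by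
  refine (norm_sum_le _ _).trans ?_
  simp [hu]

lemma norm_sum_pow_le {b : ℕ} (hb : 2 ≤ b) {u : ℂ} (hu : ‖u‖ = 1) {ε : ℝ} (hε : 0 ≤ ε)
    (h : ε ≤ ‖u - 1‖) : ‖∑ c ∈ range b, u ^ c‖ ≤ b - ε ^ 2 / 4 := by
  obtain ⟨a, rfl⟩ := Nat.exists_eq_add_of_le hb
  rw [sum_range_add]
  have h1 : ‖∑ x ∈ range a, u ^ (2 + x)‖ ≤ a := by
    refine (norm_sum_le _ _).trans ?_
    simp [hu]
  have h2 : ‖∑ x ∈ range 2, u ^ x‖ ≤ 2 - ε ^ 2 / 4 := by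
    have h3 := parallelogram_law_with_norm ℝ u 1
    rw [hu, norm_one] at h3
    have h4 : ‖u - 1‖ ≤ 2 := by
      refine (norm_sub_le _ _).trans ?_
      rw [hu, norm_one]; norm_num
    have h5 : ∑ x ∈ range 2, u ^ x = u + 1 := by
      simp [sum_range_succ, add_comm]
    rw [h5]
    refine abs_le_of_sq_le_sq' ?_ (by nlinarith) |>.2
    nlinarith [sq_nonneg (ε ^ 2)]
  refine (norm_add_le _ _).trans ?_
  push_cast
  linarith

lemma norm_pow_sub_one_ge {b : ℕ} (hb : 2 ≤ b) {u : ℂ} (hu : ‖u‖ = 1)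
    (h : ‖u - 1‖ ≤ 1 / (b : ℝ) ^ 2) : 3 / 2 * ‖u - 1‖ ≤ ‖u ^ b - 1‖ := by
  have hb2 : (2 : ℝ) ≤ b := by exact_mod_cast hb
  have h1 : u ^ b - 1 = (∑ c ∈ range b, u ^ c) * (u - 1) := (geom_sum_mul u b).symm
  rw [h1, norm_mul]
  refine mul_le_mul_of_nonneg_right ?_ (norm_nonneg _)
  have h2 : ‖∑ c ∈ range b, (u ^ c - 1)‖ ≤ 1 / 2 := by
    refine (norm_sum_le _ _).trans ?_
    calc ∑ c ∈ range b, ‖u ^ c - 1‖ ≤ ∑ c ∈ range b, (c : ℝ) * (1 / (b : ℝ) ^ 2) :=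
          sum_le_sum fun c _ => (norm_pow_sub_one_le hu c).trans (by gcongr)
      _ = (∑ c ∈ range b, (c : ℝ)) * (1 / (b : ℝ) ^ 2) := by rw [sum_mul]
      _ = (b * (b - 1) / 2) * (1 / (b : ℝ) ^ 2) := by
          congr 1
          have := Finset.sum_range_id_mul_two b
          have h3 : ((∑ i ∈ range b, i : ℕ) : ℝ) * 2 = b * (b - 1) := by
            rw [← Nat.cast_pred (by omega)]
            exact_mod_cast this
          push_cast at h3
          linarith
      _ ≤ 1 / 2 := by
          rw [mul_one_div, div_le_iff₀ (by positivity)]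
          nlinarith
  have h3 : (b : ℂ) = ∑ c ∈ range b, u ^ c - ∑ c ∈ range b, (u ^ c - 1) := by
    rw [sum_sub_distrib]; simp
  have h4 : (b : ℝ) ≤ ‖∑ c ∈ range b, u ^ c‖ + ‖∑ c ∈ range b, (u ^ c - 1)‖ := by
    calc (b : ℝ) = ‖(b : ℂ)‖ := by simp
      _ ≤ _ := by rw [h3]; exact norm_sub_le _ _
  linarith

lemma one_le_mul_norm_sub_one {q : ℕ} (hq : 0 < q) {w : ℂ} (h1 : w ^ q = 1) (h : w ≠ 1) :
    1 ≤ q * ‖w - 1‖ := by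
  have hw : ‖w‖ = 1 := Complex.norm_eq_one_of_pow_eq_one h1 hq.ne'
  have h0 : ∑ i ∈ range q, w ^ i = 0 := by
    have := geom_sum_mul w q
    rw [h1, sub_self] at this
    exact (mul_eq_zero.1 this).resolve_right (sub_ne_zero.2 h)
  have h2 : (q : ℂ) = -∑ i ∈ range q, (w ^ i - 1) := by
    rw [sum_sub_distrib, h0]; simp
  have h3 : (q : ℝ) ≤ q * (q * ‖w - 1‖) := by
    calc (q : ℝ) = ‖(q : ℂ)‖ := by simp
      _ = ‖∑ i ∈ range q, (w ^ i - 1)‖ := by rw [h2, norm_neg]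
      _ ≤ ∑ i ∈ range q, ‖w ^ i - 1‖ := norm_sum_le _ _
      _ ≤ ∑ i ∈ range q, (q * ‖w - 1‖) := by
          refine sum_le_sum fun i hi => (norm_pow_sub_one_le hw i).trans ?_
          gcongr
          exact (mem_range.1 hi).le
      _ = _ := by simp
  have hq' : (0 : ℝ) < q := by exact_mod_cast hq
  exact le_of_mul_le_mul_left (by linarith) hq'

/-- The distance from `1` that some digit factor has to attain in every window. -/
noncomputable def sep (b : ℕ) : ℝ := 1 / ((b : ℝ) ^ 2 * (b + 1))

/-- The saving obtained in every window. -/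
noncomputable def saving (b : ℕ) : ℝ := 1 - sep b ^ 2 / (4 * b)

lemma sep_pos {b : ℕ} (hb : 2 ≤ b) : 0 < sep b := by
  unfold sep; positivity

lemma sep_le {b : ℕ} (hb : 2 ≤ b) : sep b ≤ 1 / 12 := by
  have hb2 : (2 : ℝ) ≤ b := by exact_mod_cast hb
  unfold sep
  gcongr
  nlinarith

lemma saving_lt_one {b : ℕ} (hb : 2 ≤ b) : saving b < 1 := by
  have := sep_pos hb
  have : 0 < sep b ^ 2 / (4 * b) := by positivity
  unfold saving
  linarith

lemma le_saving {b : ℕ} (hb : 2 ≤ b) : 9 / 10 ≤ saving b := by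
  have h1 := sep_pos hb
  have h2 := sep_le hb
  have hb2 : (2 : ℝ) ≤ b := by exact_mod_cast hb
  have : sep b ^ 2 / (4 * b) ≤ 1 / 10 := by
    rw [div_le_iff₀ (by positivity)]
    nlinarith
  unfold saving
  linarith

lemma exists_sep_le {b : ℕ} (hb : 2 ≤ b) {q s : ℕ} (hq : 0 < q) (hs : (q : ℝ) ≤ (3 / 2) ^ s)
    {w : ℂ} (hw : w ^ q = 1) (hw1 : w ≠ 1) {y : ℕ → ℂ} (hy : ∀ i, ‖y i‖ = 1)
    (hyw : ∀ i ≤ s, y (i + 1) ^ b = y i * w ^ b ^ i) : ∃ i < s + 2, sep b ≤ ‖y i - 1‖ := by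
  by_contra! hcon
  have hw2 : ‖w‖ = 1 := Complex.norm_eq_one_of_pow_eq_one hw hq.ne'
  have hb2 : (2 : ℝ) ≤ b := by exact_mod_cast hb
  have h1 : ∀ i ≤ s, ‖w ^ b ^ i - 1‖ ≤ 1 / (b : ℝ) ^ 2 := by
    intro i hi
    calc ‖w ^ b ^ i - 1‖ = ‖y i * (w ^ b ^ i - 1)‖ := by rw [norm_mul, hy, one_mul]
      _ = ‖(y (i + 1) ^ b - 1) - (y i - 1)‖ := by rw [hyw i hi]; ring_nf
      _ ≤ ‖y (i + 1) ^ b - 1‖ + ‖y i - 1‖ := norm_sub_le _ _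
      _ ≤ b * sep b + sep b := by
          refine add_le_add ((norm_pow_sub_one_le (hy _) b).trans ?_) (hcon i (by omega)).le
          gcongr
          exact (hcon (i + 1) (by omega)).le
      _ = 1 / (b : ℝ) ^ 2 := by unfold sep; field_simp
  have h2 : ∀ i ≤ s, (3 / 2 : ℝ) ^ i * ‖w - 1‖ ≤ ‖w ^ b ^ i - 1‖ := by
    intro i
    induction i with
    | zero => simp
    | succ i ih =>
      intro hi
      have h3 := norm_pow_sub_one_ge hb (u := w ^ b ^ i) (by rw [norm_pow, hw2, one_pow])
        (h1 i (by omega))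
      rw [← pow_mul, ← pow_succ] at h3
      have := ih (by omega)
      rw [pow_succ]
      linarith
  have h3 := one_le_mul_norm_sub_one hq hw hw1
  have h4 : (1 : ℝ) ≤ 1 / (b : ℝ) ^ 2 := by
    calc (1 : ℝ) ≤ q * ‖w - 1‖ := h3
      _ ≤ (3 / 2) ^ s * ‖w - 1‖ := by gcongr
      _ ≤ _ := (h2 s le_rfl).trans (h1 s le_rfl)
  rw [le_div_iff₀ (by positivity)] at h4
  nlinarith

lemma norm_palSum_eq_prod {b : ℕ} (z : ℂ) : ∀ (σ : ℕ) (N : ℕ), 2 * σ ≤ N →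
    ‖palSum b N z‖ = (∏ i ∈ range σ, ‖∑ c ∈ range b, (z ^ (b ^ (N - i - 1) + b ^ i)) ^ c‖) *
      ‖palSum b (N - 2 * σ) (z ^ b ^ σ)‖ := by
  intro σ N h
  induction σ with
  | zero => simp
  | succ σ ih =>
    rw [ih (by omega), prod_range_succ]
    obtain ⟨M, hM⟩ : ∃ M, N - 2 * σ = M + 2 := ⟨N - 2 * σ - 2, by omega⟩
    rw [hM, palSum_add_two, norm_mul, show N - 2 * (σ + 1) = M by omega, ← pow_mul, ← pow_mul,
      ← pow_succ, mul_assoc, show N - σ - 1 = σ + (M + 1) by omega, pow_add b σ]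
    ring_nf

/-- Every window of digits yields a saving in the exponential sum. -/
lemma norm_palSum_le_window {b : ℕ} (hb : 2 ≤ b) {q s N : ℕ} (hq : 0 < q)
    (hs : (q : ℝ) ≤ (3 / 2) ^ s) (hN : 2 * (s + 2) ≤ N) {z : ℂ} (hz : ‖z‖ = 1)
    (hzq : (z ^ (b ^ 2 - 1)) ^ q = 1) (hz1 : z ^ (b ^ 2 - 1) ≠ 1) :
    ‖palSum b N z‖ ≤ b ^ (s + 2) * saving b *
      ‖palSum b (N - 2 * (s + 2)) (z ^ b ^ (s + 2))‖ := by
  rw [norm_palSum_eq_prod z (s + 2) N hN]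
  refine mul_le_mul_of_nonneg_right ?_ (norm_nonneg _)
  set y : ℕ → ℂ := fun i => z ^ (b ^ (N - i - 1) + b ^ i) with hy
  have hy1 : ∀ i, ‖y i‖ = 1 := fun i => by rw [hy]; simp [hz]
  obtain ⟨i, hi, hi2⟩ := exists_sep_le hb hq hs hzq hz1 hy1 (by
    intro i hi
    simp only [hy]
    rw [← pow_mul, ← pow_mul, ← pow_add]
    congr 1
    obtain ⟨M, rfl⟩ : ∃ M, N = M + i + 2 := ⟨N - i - 2, by omega⟩
    rw [show M + i + 2 - (i + 1) - 1 = M by omega, show M + i + 2 - i - 1 = M + 1 by omega]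
    have : 1 ≤ b ^ 2 := Nat.one_le_pow _ _ (by omega)
    zify [this]
    ring)
  have hb0 : (0 : ℝ) < b := by positivity
  rw [← mul_prod_erase _ _ (mem_range.2 hi)]
  have h1 := norm_sum_pow_le hb (hy1 i) (sep_pos hb).le hi2
  have h2 : ∏ j ∈ (range (s + 2)).erase i, ‖∑ c ∈ range b, (y j) ^ c‖ ≤
      (b : ℝ) ^ (s + 1) := by
    calc ∏ j ∈ (range (s + 2)).erase i, ‖∑ c ∈ range b, (y j) ^ c‖
        ≤ ∏ j ∈ (range (s + 2)).erase i, (b : ℝ) :=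
          prod_le_prod (fun _ _ => norm_nonneg _) fun j _ => norm_sum_pow_le_card (hy1 j) b
      _ = _ := by rw [prod_const, card_erase_of_mem (mem_range.2 hi), card_range]; simp
  calc _ ≤ (b - sep b ^ 2 / 4) * (b : ℝ) ^ (s + 1) := by
        refine mul_le_mul h1 h2 (prod_nonneg fun _ _ => norm_nonneg _) ?_
        exact (norm_nonneg _).trans h1
    _ = _ := by unfold saving; field_simp; ring

lemma norm_palSum_le {b : ℕ} (hb : 2 ≤ b) {q s : ℕ} (hq : 0 < q) (hqb : q.Coprime b)
    (hs : (q : ℝ) ≤ (3 / 2) ^ s) : ∀ (k N : ℕ), 2 * (s + 2) * k ≤ N → ∀ z : ℂ, ‖z‖ = 1 →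
    (z ^ (b ^ 2 - 1)) ^ q = 1 → z ^ (b ^ 2 - 1) ≠ 1 →
    ‖palSum b N z‖ ≤ saving b ^ k * (b : ℝ) ^ ((N + 1) / 2)
  | 0, N, _, z, hz, _, _ => by
    refine (norm_sum_le _ _).trans ?_
    simp only [norm_pow, hz, one_pow, sum_const, nsmul_eq_mul, mul_one, pow_zero, one_mul]
    exact_mod_cast card_pal_le b N
  | k + 1, N, hN, z, hz, hzq, hz1 => by
    have h0 := (le_saving hb)
    have hN' : 2 * (s + 2) * k + 2 * (s + 2) ≤ N := by linarith
    refine (norm_palSum_le_window hb hq hs (by omega) hz hzq hz1).trans ?_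
    have hc : (z ^ b ^ (s + 2)) ^ (b ^ 2 - 1) = (z ^ (b ^ 2 - 1)) ^ b ^ (s + 2) := by
      rw [← pow_mul, ← pow_mul, mul_comm]
    have ih := norm_palSum_le hb hq hqb hs k (N - 2 * (s + 2)) (by omega) (z ^ b ^ (s + 2))
      (by rw [norm_pow, hz, one_pow]) (by rw [hc, ← pow_mul, mul_comm, pow_mul, hzq, one_pow])
      (by
        rw [hc]
        intro h
        apply hz1
        have h1 := Nat.dvd_gcd (orderOf_dvd_of_pow_eq_one h) (orderOf_dvd_of_pow_eq_one hzq)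
        rw [Nat.Coprime.pow_left _ hqb.symm, Nat.dvd_one, orderOf_eq_one_iff] at h1
        exact h1)
    calc _ ≤ b ^ (s + 2) * saving b * (saving b ^ k * (b : ℝ) ^ ((N - 2 * (s + 2) + 1) / 2)) := by
          gcongr
      _ = saving b ^ (k + 1) * ((b : ℝ) ^ (s + 2) * (b : ℝ) ^ ((N - 2 * (s + 2) + 1) / 2)) := by ring
      _ = _ := by rw [← pow_add]; congr 2; omega
lemma norm_sum_prefix_mul_pow_le {b : ℕ} : ∀ {s N : ℕ}, 2 * s ≤ N → ∀ {z : ℂ}, ‖z‖ = 1 →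
    ∀ {F : ℕ → ℂ}, (∀ u, ‖F u‖ ≤ 1) →
    ‖∑ n ∈ pal b N, F (n / b ^ (N - s)) * z ^ n‖ ≤ b ^ s * ‖palSum b (N - 2 * s) (z ^ b ^ s)‖
  | 0, N, _, z, _, F, hF => by
    have : ∀ n ∈ pal b N, F (n / b ^ (N - 0)) * z ^ n = F 0 * z ^ n := fun n hn => by
      rw [Nat.sub_zero, Nat.div_eq_of_lt (pal_lt hn)]
    rw [sum_congr rfl this, ← mul_sum, norm_mul]
    simp only [pow_zero, one_mul, mul_zero, Nat.sub_zero, pow_one]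
    exact mul_le_of_le_one_left (norm_nonneg _) (hF 0)
  | s + 1, N, hs, z, hz, F, hF => by
    obtain ⟨M, rfl⟩ : ∃ M, N = M + 2 := ⟨N - 2, by omega⟩
    rw [sum_pal_add_two, show M + 2 - (s + 1) = M - s + 1 by omega,
      show M + 2 - 2 * (s + 1) = M - 2 * s by omega, pow_succ' (b : ℝ), mul_assoc]
    have hone : ∀ c ∈ range b, ‖∑ W ∈ pal b M, F ((c * (b ^ (M + 1) + 1) + b * W) /
        b ^ (M - s + 1)) * z ^ (c * (b ^ (M + 1) + 1) + b * W)‖ ≤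
        b ^ s * ‖palSum b (M - 2 * s) (z ^ b ^ (s + 1))‖ := by
      intro c hc
      have h1 := norm_sum_prefix_mul_pow_le (b := b) (s := s) (N := M) (by omega) (z := z ^ b)
        (by rw [norm_pow, hz, one_pow]) (F := fun u => F (c * b ^ s + u)) (fun u => hF _)
      rw [← pow_mul, ← pow_succ'] at h1
      have h2 : ‖z ^ (c * (b ^ (M + 1) + 1))‖ = 1 := by rw [norm_pow, hz, one_pow]
      refine le_of_eq_of_le ?_ h1
      rw [← one_mul ‖∑ n ∈ pal b M, F (c * b ^ s + n / b ^ (M - s)) * _‖, ← h2, ← norm_mul, mul_sum]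
      congr 1
      refine sum_congr rfl fun W _ => ?_
      rw [outer_div_pow (by omega) (mem_range.1 hc), pow_add z _ (b * W), pow_mul z b W]
      ring
    refine (norm_sum_le _ _).trans ((sum_le_card_nsmul _ _ _ hone).trans ?_)
    rw [card_range, nsmul_eq_mul]

lemma card_filter_prefix_le {b : ℕ} (hb : 0 < b) : ∀ {s N : ℕ}, 2 * s ≤ N → ∀ u : ℕ,
    ((pal b N).filter fun n => n / b ^ (N - s) = u).card ≤ b ^ ((N - 2 * s + 1) / 2)
  | 0, N, _, u => (card_filter_le _ _).trans (card_pal_le b N)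
  | s + 1, N, hs, u => by
    obtain ⟨M, rfl⟩ : ∃ M, N = M + 2 := ⟨N - 2, by omega⟩
    rw [card_filter, sum_pal_add_two, show M + 2 - (s + 1) = M - s + 1 by omega,
      show M + 2 - 2 * (s + 1) = M - 2 * s by omega]
    have ih := card_filter_prefix_le hb (s := s) (N := M) (by omega)
      (u - u / b ^ s * b ^ s)
    refine le_trans ?_ ih
    rw [card_filter]
    have hlt : ∀ W ∈ pal b M, W / b ^ (M - s) < b ^ s := by
      intro W hW
      have h1 := pal_lt hW
      rw [Nat.div_lt_iff_lt_mul (by positivity), ← pow_add, show s + (M - s) = M by omega]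
      exact h1
    rw [sum_comm]
    refine sum_le_sum fun W hW => ?_
    have h1 := hlt W hW
    by_cases hu : W / b ^ (M - s) = u - u / b ^ s * b ^ s
    · rw [if_pos hu]
      refine (sum_le_sum (g := fun c => if c = u / b ^ s then 1 else 0) fun c hc => ?_).trans ?_
      · rw [outer_div_pow (by omega) (mem_range.1 hc)]
        split_ifs with h2 h3
        · rfl
        · exfalso
          apply h3
          rw [← h2, add_comm, Nat.add_mul_div_right _ _ (by positivity), Nat.div_eq_of_lt h1, zero_add]
        · exact Nat.zero_le _
        · rfl
      · rw [sum_ite_eq']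
        split_ifs <;> omega
    · rw [if_neg hu]
      refine le_of_eq (sum_eq_zero fun c hc => ?_)
      rw [outer_div_pow (by omega) (mem_range.1 hc), if_neg]
      intro h2
      apply hu
      have : u / b ^ s = c := by
        rw [← h2, add_comm, Nat.add_mul_div_right _ _ (by positivity), Nat.div_eq_of_lt h1, zero_add]
      rw [this]
      exact Nat.eq_sub_of_add_eq' h2

/-- Orthogonality of additive characters. -/
lemma sum_pow_eq_ite {q n : ℕ} {ζ : ℂ} (hζ : IsPrimitiveRoot ζ q) :
    ∑ h ∈ range q, (ζ ^ h) ^ n = if q ∣ n then (q : ℂ) else 0 := by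
  have h0 : ∀ h, (ζ ^ h) ^ n = (ζ ^ n) ^ h := fun h => by rw [← pow_mul, ← pow_mul, mul_comm]
  simp only [h0]
  split_ifs with h
  · rw [(hζ.pow_eq_one_iff_dvd n).2 h]
    simp
  · have h1 := geom_sum_mul (ζ ^ n) q
    rw [← pow_mul, mul_comm n, pow_mul, hζ.pow_eq_one, one_pow, sub_self] at h1
    refine (mul_eq_zero.1 h1).resolve_right (sub_ne_zero.2 fun h2 => h ?_)
    exact (hζ.pow_eq_one_iff_dvd n).1 h2

lemma exists_coprime_coeff {r : ℕ} (hr : 0 < r) {ζ : ℂ} (hζ : IsPrimitiveRoot ζ r) :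
    ∃ κ : ℕ → ℂ, (∀ a, ‖κ a‖ ≤ 1) ∧
      ∀ n : ℕ, (if n.Coprime r then (1 : ℂ) else 0) = ∑ a ∈ range r, κ a * (ζ ^ a) ^ n := by
  have hnorm : ‖ζ‖ = 1 := hζ.norm'_eq_one hr.ne'
  have hr0 : (r : ℂ) ≠ 0 := by exact_mod_cast hr.ne'
  refine ⟨fun a => (r : ℂ)⁻¹ * ∑ c ∈ (range r).filter (fun c => c.Coprime r),
    (ζ ^ a) ^ (r - c), fun a => ?_, fun n => ?_⟩
  · rw [norm_mul, norm_inv, Complex.norm_natCast, inv_mul_le_iff₀ (by exact_mod_cast hr), mul_one]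
    refine (norm_sum_le _ _).trans ?_
    simp only [norm_pow, hnorm, one_pow, sum_const, nsmul_eq_mul, mul_one]
    have := card_filter_le (range r) fun c => c.Coprime r
    rw [card_range] at this
    exact_mod_cast this
  · simp only [mul_assoc, sum_mul]
    rw [← mul_sum, sum_comm]
    have h1 : ∀ c ∈ (range r).filter (fun c => c.Coprime r),
        ∑ a ∈ range r, (ζ ^ a) ^ (r - c) * (ζ ^ a) ^ n = if c = n % r then (r : ℂ) else 0 := by
      intro c hc
      have hc' := mem_range.1 (mem_filter.1 hc).1
      simp only [← pow_add]
      have h2 := sum_pow_eq_ite (n := r - c + n) hζ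
      simp only [← pow_mul] at h2 ⊢
      rw [h2]
      congr 1
      rw [eq_iff_iff]
      constructor
      · intro h
        have h3 : n ≡ c [MOD r] := by
          have h4 : r - c + n ≡ r - c + c [MOD r] := by
            rw [Nat.sub_add_cancel hc'.le]
            exact ((Nat.modEq_zero_iff_dvd.2 h)).trans (Nat.modEq_zero_iff_dvd.2 dvd_rfl).symm
          exact Nat.ModEq.add_left_cancel' _ h4
        rw [h3, Nat.mod_eq_of_lt hc']
      · rintro rfl
        have h3 := Nat.mod_add_div n r
        refine ⟨n / r + 1, ?_⟩
        rw [mul_add]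
        omega
    rw [sum_congr rfl h1, sum_ite_eq']
    simp only [mem_filter, mem_range, Nat.mod_lt n hr, true_and]
    have : (n % r).Coprime r ↔ n.Coprime r := by
      unfold Nat.Coprime
      rw [← Nat.gcd_rec, Nat.gcd_comm]
    simp only [this]
    split_ifs
    · field_simp
    · simp
lemma coprime_iff_of_mem_pal {b N n : ℕ} (h : n ∈ pal b (N + 2)) :
    n.Coprime b ↔ (n / b ^ (N + 1)).Coprime b := by
  obtain ⟨c, W, hc, hW, rfl⟩ := mem_pal_add_two.1 h
  rw [outer_div hc (pal_lt hW),
    show c * (b ^ (N + 1) + 1) + b * W = c + b * (c * b ^ N + W) by ring]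
  exact Nat.coprime_add_mul_left_left _ _ _

lemma cube_sub_self (b : ℕ) : b ^ 3 - b = b * (b ^ 2 - 1) := by
  rw [Nat.mul_sub, mul_one]; ring_nf

lemma coprime_cube_sub_self {b n : ℕ} :
    n.Coprime (b ^ 3 - b) ↔ n.Coprime b ∧ n.Coprime (b ^ 2 - 1) := by
  rw [cube_sub_self, Nat.coprime_mul_iff_right]

/-- Palindromes of length `N` up to `x`, coprime to `b ^ 3 - b`. -/
def goodPal (b x N : ℕ) : Finset ℕ := (pal b N).filter fun n => n ≤ x ∧ n.Coprime (b ^ 3 - b)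

lemma sum_dvd_sub_inv {q n : ℕ} (hq : 0 < q) {ζ : ℂ} (hζ : IsPrimitiveRoot ζ q) :
    (if q ∣ n then (1 : ℂ) else 0) - 1 / q = (q : ℂ)⁻¹ * ∑ h ∈ Ico 1 q, (ζ ^ h) ^ n := by
  have h := sum_pow_eq_ite (n := n) hζ
  rw [sum_range_eq_add_Ico _ hq, pow_zero, one_pow] at h
  have hq0 : (q : ℂ) ≠ 0 := by exact_mod_cast hq.ne'
  rw [← eq_sub_iff_add_eq'] at h
  rw [h]
  split_ifs
  · field_simp
  · field_simp
    ring

lemma norm_dvd_sub_inv_le {q : ℕ} (hq : 0 < q) (n : ℕ) :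
    ‖(if q ∣ n then (1 : ℂ) else 0) - 1 / q‖ ≤ 1 := by
  have hq1 : (1 : ℝ) ≤ q := by exact_mod_cast hq
  have h1 : (1 : ℝ) / q ≤ 1 := by rw [div_le_one (by linarith)]; exact hq1
  have h0 : (0 : ℝ) ≤ 1 / q := by positivity
  have : (if q ∣ n then (1 : ℂ) else 0) - 1 / q =
      (((if q ∣ n then (1 : ℝ) else 0) - 1 / q : ℝ) : ℂ) := by
    push_cast; split_ifs <;> simp
  rw [this, Complex.norm_real, Real.norm_eq_abs, abs_le]
  split_ifs <;> constructor <;> linarith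

/-- Twisted prefix sums of palindromes have cancellation modulo `q`. -/
lemma norm_sum_prefix_le {b : ℕ} (hb : 2 ≤ b) {q s N s₀ k : ℕ} (hq : 0 < q)
    (hqb : q.Coprime (b ^ 3 - b)) (hs : (q : ℝ) ≤ (3 / 2) ^ s) (hs₀ : 2 * s₀ ≤ N)
    (hk : 2 * (s + 2) * k ≤ N - 2 * s₀) {F : ℕ → ℂ} (hF : ∀ u, ‖F u‖ ≤ 1) :
    ‖∑ n ∈ pal b N, F (n / b ^ (N - s₀)) * (if n.Coprime (b ^ 2 - 1) then (1 : ℂ) else 0) *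
      ((if q ∣ n then (1 : ℂ) else 0) - 1 / q)‖ ≤
      (b ^ 2 - 1 : ℕ) * (saving b ^ k * (b : ℝ) ^ ((N + 1) / 2)) := by
  obtain ⟨hqb1, hqr⟩ := coprime_cube_sub_self.1 hqb
  set r := b ^ 2 - 1 with hr
  have hr0 : 0 < r := by
    have : 2 ^ 2 ≤ b ^ 2 := Nat.pow_le_pow_left hb 2
    omega
  have hζ := Complex.isPrimitiveRoot_exp q hq.ne'
  have hη := Complex.isPrimitiveRoot_exp r hr0.ne'
  set ζ := Complex.exp (2 * Real.pi * Complex.I / q)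
  set η := Complex.exp (2 * Real.pi * Complex.I / r)
  obtain ⟨κ, hκ, hκ2⟩ := exists_coprime_coeff hr0 hη
  have hζ1 : ‖ζ‖ = 1 := hζ.norm'_eq_one hq.ne'
  have hη1 : ‖η‖ = 1 := hη.norm'_eq_one hr0.ne'
  have hb0 : (0 : ℝ) < b := by positivity
  have h09 := le_saving hb
  set B := saving b ^ k * (b : ℝ) ^ ((N + 1) / 2) with hB
  have hB0 : 0 ≤ B := by positivity
  have hterm : ∀ a, ∀ h ∈ Ico 1 q,
      ‖∑ n ∈ pal b N, F (n / b ^ (N - s₀)) * (η ^ a * ζ ^ h) ^ n‖ ≤ B := by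
    intro a h hh
    rw [mem_Ico] at hh
    have hz : ‖η ^ a * ζ ^ h‖ = 1 := by simp [hζ1, hη1]
    refine (norm_sum_prefix_mul_pow_le hs₀ hz hF).trans ?_
    have hw : (η ^ a * ζ ^ h) ^ r = ζ ^ (h * r) := by
      rw [mul_pow, ← pow_mul, mul_comm a, pow_mul, hη.pow_eq_one, one_pow, one_mul, ← pow_mul]
    have hw2 : ((η ^ a * ζ ^ h) ^ b ^ s₀) ^ r = ζ ^ (h * r * b ^ s₀) := by
      rw [← pow_mul, mul_comm (b ^ s₀), pow_mul, hw, ← pow_mul]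
    have := norm_palSum_le hb hq hqb1 hs k (N - 2 * s₀) hk ((η ^ a * ζ ^ h) ^ b ^ s₀)
      (by rw [norm_pow, hz, one_pow])
      (by rw [← hr, hw2, ← pow_mul, mul_comm, pow_mul, hζ.pow_eq_one, one_pow])
      (by
        rw [← hr, hw2]
        intro h1
        have h2 := (hζ.pow_eq_one_iff_dvd _).1 h1
        have h3 := (hqb1.pow_right s₀).dvd_of_dvd_mul_right h2
        have h4 := hqr.dvd_of_dvd_mul_right h3
        have := Nat.le_of_dvd (by omega) h4
        omega)
    calc _ ≤ (b : ℝ) ^ s₀ * (saving b ^ k * (b : ℝ) ^ ((N - 2 * s₀ + 1) / 2)) := by gcongr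
      _ = saving b ^ k * ((b : ℝ) ^ s₀ * (b : ℝ) ^ ((N - 2 * s₀ + 1) / 2)) := by ring
      _ = B := by rw [← pow_add, hB]; congr 2; omega
  have hexp : ∑ n ∈ pal b N, F (n / b ^ (N - s₀)) * (if n.Coprime r then (1 : ℂ) else 0) *
      ((if q ∣ n then (1 : ℂ) else 0) - 1 / q) = (q : ℂ)⁻¹ * ∑ h ∈ Ico 1 q, ∑ a ∈ range r,
        κ a * ∑ n ∈ pal b N, F (n / b ^ (N - s₀)) * (η ^ a * ζ ^ h) ^ n := by
    have : ∀ n ∈ pal b N, F (n / b ^ (N - s₀)) * (if n.Coprime r then (1 : ℂ) else 0) *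
      ((if q ∣ n then (1 : ℂ) else 0) - 1 / q) = (q : ℂ)⁻¹ * ∑ h ∈ Ico 1 q, ∑ a ∈ range r,
        κ a * (F (n / b ^ (N - s₀)) * (η ^ a * ζ ^ h) ^ n) := by
      intro n _
      rw [hκ2, sum_dvd_sub_inv hq hζ]
      simp only [mul_sum, sum_mul]
      refine sum_congr rfl fun h _ => sum_congr rfl fun a _ => ?_
      rw [mul_pow]; ring
    rw [sum_congr rfl this, ← mul_sum, sum_comm]
    congr 1
    refine sum_congr rfl fun h _ => ?_
    rw [sum_comm]
    exact sum_congr rfl fun a _ => by rw [mul_sum]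
  rw [hexp, norm_mul, norm_inv, Complex.norm_natCast]
  have hq' : (0 : ℝ) < q := by exact_mod_cast hq
  rw [inv_mul_le_iff₀ hq']
  refine (norm_sum_le_of_le (f := fun h => ∑ a ∈ range r, κ a * ∑ n ∈ pal b N,
    F (n / b ^ (N - s₀)) * (η ^ a * ζ ^ h) ^ n) _ (n := fun _ => r * B) fun h hh => ?_).trans ?_
  · refine (norm_sum_le_of_le _ (n := fun _ => B) fun a _ => ?_).trans (by simp)
    rw [norm_mul]
    exact (mul_le_of_le_one_left (norm_nonneg _) (hκ a)).trans (hterm a h hh)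
  · simp only [sum_const, Nat.card_Ico, nsmul_eq_mul]
    have : ((q - 1 : ℕ) : ℝ) ≤ q := by exact_mod_cast Nat.sub_le q 1
    gcongr

/-- Equidistribution of palindromes of fixed length in the zero class modulo `q`. -/
lemma norm_sum_goodPal_le {b : ℕ} (hb : 2 ≤ b) {q s : ℕ} (hq : 0 < q)
    (hqb : q.Coprime (b ^ 3 - b)) (hs : (q : ℝ) ≤ (3 / 2) ^ s) (x N : ℕ) :
    ‖∑ n ∈ goodPal b x N, ((if q ∣ n then (1 : ℂ) else 0) - 1 / q)‖ ≤
      (b : ℝ) ^ 2 * (saving b ^ (N / 4 / (s + 2)) * (b : ℝ) ^ ((N + 1) / 2)) := by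
  have hb1 : (1 : ℝ) ≤ b := by exact_mod_cast (by omega : 1 ≤ b)
  have hb2 : (1 : ℝ) ≤ (b : ℝ) ^ 2 := one_le_pow₀ hb1
  have h09 := le_saving hb
  have h1 := saving_lt_one hb
  rcases lt_or_ge N 4 with hN | hN
  · have : N / 4 / (s + 2) = 0 := by rw [Nat.div_eq_of_lt hN, Nat.zero_div]
    rw [this, pow_zero, one_mul]
    refine (norm_sum_le_of_le _ fun n _ => norm_dvd_sub_inv_le hq n).trans ?_
    rw [sum_const, nsmul_eq_mul, mul_one]
    have h2 : ((goodPal b x N).card : ℝ) ≤ (b : ℝ) ^ ((N + 1) / 2) := by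
      exact_mod_cast (card_filter_le _ _).trans (card_pal_le b N)
    have h3 : (0 : ℝ) ≤ (b : ℝ) ^ ((N + 1) / 2) := by positivity
    nlinarith
  obtain ⟨s₁, hs₁⟩ : ∃ s₁, N / 4 = s₁ + 1 := ⟨N / 4 - 1, by omega⟩
  set k := N / 4 / (s + 2) with hk
  have hkN : (s + 2) * k ≤ N / 4 := Nat.mul_div_le _ _
  rw [hs₁] at hkN
  set s₀ := s₁ + 1 with hs₀
  set X := b ^ (N - s₀) with hX
  set F : ℕ → ℂ := fun u => if u < x / X ∧ (u / b ^ s₁).Coprime b then 1 else 0 with hFdef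
  have hX0 : 0 < X := by rw [hX]; exact pow_pos (by omega) _
  have hF : ∀ u, ‖F u‖ ≤ 1 := fun u => by rw [hFdef]; simp only; split_ifs <;> simp
  set E : ℕ → ℂ := fun n => (if q ∣ n then (1 : ℂ) else 0) - 1 / q with hE
  have hdecomp : ∀ n ∈ pal b N, (if n ≤ x ∧ n.Coprime (b ^ 3 - b) then E n else 0) =
      F (n / X) * (if n.Coprime (b ^ 2 - 1) then (1 : ℂ) else 0) * E n +
      if n / X = x / X then (if n ≤ x ∧ n.Coprime (b ^ 3 - b) then E n else 0) else 0 := by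
    intro n hn
    obtain ⟨M, rfl⟩ : ∃ M, N = M + 2 := ⟨N - 2, by omega⟩
    have hlead : n / X / b ^ s₁ = n / b ^ (M + 1) := by
      rw [Nat.div_div_eq_div_mul, hX, ← pow_add]
      congr 2; omega
    by_cases hu : n / X = x / X
    · rw [if_pos hu]
      simp [hFdef, hu]
    · rw [if_neg hu, add_zero]
      have hle : n ≤ x ↔ n / X < x / X := by
        constructor
        · intro h
          exact lt_of_le_of_ne (Nat.div_le_div_right h) hu
        · intro h
          by_contra hcon
          exact absurd (Nat.div_le_div_right (c := X) (not_le.1 hcon).le) (not_le.2 h)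
      simp only [hFdef, hlead, ← coprime_iff_of_mem_pal hn, coprime_cube_sub_self, hle]
      split_ifs <;> first | (exfalso; tauto) | simp
  have hsum : ∑ n ∈ goodPal b x N, E n =
      ∑ n ∈ pal b N, F (n / X) * (if n.Coprime (b ^ 2 - 1) then (1 : ℂ) else 0) * E n +
      ∑ n ∈ (pal b N).filter (fun n => n / X = x / X),
        (if n ≤ x ∧ n.Coprime (b ^ 3 - b) then E n else 0) := by
    rw [goodPal, sum_filter, sum_congr rfl hdecomp, sum_add_distrib]
    congr 1
    exact (sum_filter _ _).symm
  rw [hsum]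
  have hA := norm_sum_prefix_le hb hq hqb hs (N := N) (s₀ := s₀) (k := k) (by omega)
    (by rw [mul_assoc]; omega) hF
  have hB : ‖∑ n ∈ (pal b N).filter (fun n => n / X = x / X),
        (if n ≤ x ∧ n.Coprime (b ^ 3 - b) then E n else 0)‖ ≤
        saving b ^ k * (b : ℝ) ^ ((N + 1) / 2) := by
    refine (norm_sum_le_of_le _ (n := fun _ => (1 : ℝ)) fun n _ => ?_).trans ?_
    · split_ifs
      · exact norm_dvd_sub_inv_le hq n
      · simp
    · rw [sum_const, nsmul_eq_mul, mul_one]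
      have h2 := card_filter_prefix_le (b := b) (by omega) (s := s₀) (N := N) (by omega) (x / X)
      calc (((pal b N).filter (fun n => n / X = x / X)).card : ℝ)
          ≤ (b : ℝ) ^ ((N - 2 * s₀ + 1) / 2) := by exact_mod_cast h2
        _ = 1 * (b : ℝ) ^ ((N - 2 * s₀ + 1) / 2) := (one_mul _).symm
        _ ≤ (saving b ^ s₀ * (b : ℝ) ^ s₀) * (b : ℝ) ^ ((N - 2 * s₀ + 1) / 2) := by
            gcongr
            rw [← mul_pow]
            refine one_le_pow₀ ?_
            have : (2 : ℝ) ≤ b := by exact_mod_cast hb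
            nlinarith
        _ = saving b ^ s₀ * (b : ℝ) ^ ((N + 1) / 2) := by
            rw [mul_assoc, ← pow_add]; congr 2; omega
        _ ≤ saving b ^ k * (b : ℝ) ^ ((N + 1) / 2) := by
            gcongr 1
            refine pow_le_pow_of_le_one (by linarith) h1.le ?_
            calc k = 1 * k := (one_mul k).symm
              _ ≤ (s + 2) * k := Nat.mul_le_mul_right _ (by omega)
              _ ≤ s₀ := hkN
  refine (norm_add_le _ _).trans ((add_le_add hA hB).trans (le_of_eq ?_))
  rw [Nat.cast_sub (Nat.one_le_pow _ _ (by omega))]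
  push_cast
  ring

/-- Equidistribution of palindromes up to `x` in the zero class modulo `q`. -/
lemma exists_abs_sum_sum_goodPal_le {b : ℕ} (hb : 2 ≤ b) : ∃ C : ℝ, 0 < C ∧ ∀ q s x N : ℕ, 0 < q →
    q.Coprime (b ^ 3 - b) → (q : ℝ) ≤ (3 / 2) ^ s →
    |∑ M ∈ range (N + 1), ∑ n ∈ goodPal b x M, ((if q ∣ n then (1 : ℝ) else 0) - 1 / q)| ≤
      C * √b ^ N * saving b ^ (N / 4 / (s + 2)) := by
  have hb2 : (2 : ℝ) ≤ b := by exact_mod_cast hb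
  set β := √(b : ℝ) with hβ
  have hβ1 : 7 / 5 < β := by rw [hβ, Real.lt_sqrt (by norm_num)]; linarith
  have hβ2 : β ^ 2 = b := Real.sq_sqrt (by linarith)
  have h09 := le_saving hb
  have h1 := saving_lt_one hb
  set D : ℝ := b ^ 2 * β with hD
  have hD0 : 0 < D := by positivity
  refine ⟨D * 10, by positivity, fun q s x N hq hqb hs => ?_⟩
  have hone : ∀ M, |∑ n ∈ goodPal b x M, ((if q ∣ n then (1 : ℝ) else 0) - 1 / q)| ≤
      D * (β ^ M * saving b ^ (M / 4 / (s + 2))) := by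
    intro M
    have h2 := norm_sum_goodPal_le hb hq hqb hs x M
    have h3 : ∑ n ∈ goodPal b x M, ((if q ∣ n then (1 : ℂ) else 0) - 1 / q) =
        ((∑ n ∈ goodPal b x M, ((if q ∣ n then (1 : ℝ) else 0) - 1 / q) : ℝ) : ℂ) := by
      push_cast
      refine sum_congr rfl fun n _ => ?_
      split_ifs <;> simp
    rw [h3, Complex.norm_real, Real.norm_eq_abs] at h2
    refine h2.trans ?_
    have h4 : (b : ℝ) ^ ((M + 1) / 2) ≤ β ^ (M + 1) := by
      rw [← hβ2, ← pow_mul]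
      exact pow_le_pow_right₀ (by linarith) (Nat.mul_div_le _ _)
    calc _ ≤ (b : ℝ) ^ 2 * (saving b ^ (M / 4 / (s + 2)) * β ^ (M + 1)) := by gcongr
      _ = _ := by rw [hD]; ring
  have hsum : ∀ N, ∑ M ∈ range (N + 1), β ^ M * saving b ^ (M / 4 / (s + 2)) ≤
      10 * (β ^ N * saving b ^ (N / 4 / (s + 2))) := by
    intro N
    induction N with
    | zero => simp
    | succ N ih =>
      rw [sum_range_succ]
      have h5 : (N + 1) / 4 / (s + 2) ≤ N / 4 / (s + 2) + 1 := by
        rw [Nat.div_div_eq_div_mul, Nat.div_div_eq_div_mul]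
        calc (N + 1) / (4 * (s + 2)) ≤ (N + 4 * (s + 2)) / (4 * (s + 2)) :=
              Nat.div_le_div_right (by omega)
          _ = _ := Nat.add_div_right _ (by omega)
      have h6 : saving b ^ (N / 4 / (s + 2) + 1) ≤ saving b ^ ((N + 1) / 4 / (s + 2)) :=
        pow_le_pow_of_le_one (by linarith) h1.le h5
      have h7 : 6 / 5 * (β ^ N * saving b ^ (N / 4 / (s + 2))) ≤
          β ^ (N + 1) * saving b ^ ((N + 1) / 4 / (s + 2)) := by
        calc 6 / 5 * (β ^ N * saving b ^ (N / 4 / (s + 2)))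
            ≤ (β * saving b) * (β ^ N * saving b ^ (N / 4 / (s + 2))) := by
              gcongr; nlinarith
          _ = β ^ (N + 1) * saving b ^ (N / 4 / (s + 2) + 1) := by ring
          _ ≤ _ := by gcongr
      have h8 : 0 ≤ β ^ (N + 1) * saving b ^ ((N + 1) / 4 / (s + 2)) := by positivity
      linarith
  calc _ ≤ ∑ M ∈ range (N + 1), |∑ n ∈ goodPal b x M, ((if q ∣ n then (1 : ℝ) else 0) - 1 / q)| :=
        abs_sum_le_sum_abs _ _
    _ ≤ ∑ M ∈ range (N + 1), D * (β ^ M * saving b ^ (M / 4 / (s + 2))) :=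
        sum_le_sum fun M _ => hone M
    _ ≤ D * (10 * (β ^ N * saving b ^ (N / 4 / (s + 2)))) := by
        rw [← mul_sum]
        gcongr
        exact hsum N
    _ = _ := by ring
/-- Palindromes of length `2 * g + 1` which are odd if the base is odd. -/
def oddPal (b g : ℕ) : Finset ℕ := (pal b (2 * g + 1)).filter fun W => Odd W ∨ Even b

lemma le_card_oddPal {b : ℕ} (hb : 2 ≤ b) : ∀ g : ℕ, b ^ g ≤ (oddPal b g).card
  | 0 => by
    rw [pow_zero, Nat.one_le_iff_ne_zero, ← Nat.pos_iff_ne_zero, card_pos]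
    exact ⟨1, mem_filter.2 ⟨by simp [pal]; omega, Or.inl odd_one⟩⟩
  | g + 1 => by
    rw [oddPal, card_filter, show 2 * (g + 1) + 1 = 2 * g + 1 + 2 by ring, sum_pal_add_two, pow_succ']
    have h : ∀ c ∈ range b, b ^ g ≤ ∑ W ∈ pal b (2 * g + 1),
        if Odd (c * (b ^ (2 * g + 1 + 1) + 1) + b * W) ∨ Even b then 1 else 0 := by
      intro c _
      refine (le_card_oddPal hb g).trans ?_
      rw [oddPal, card_filter]
      refine sum_le_sum fun W _ => ?_
      split_ifs with h1 h2
      · rfl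
      · exfalso
        apply h2
        rcases h1 with h1 | h1
        · rcases Nat.even_or_odd b with hb' | hb'
          · exact Or.inr hb'
          · left
            have h3 : Even (b ^ (2 * g + 1 + 1) + 1) := (hb'.pow).add_odd odd_one
            exact (h3.mul_left c).add_odd (hb'.mul h1)
        · exact Or.inr h1
      · exact Nat.zero_le _
      · rfl
    calc b * b ^ g = ∑ c ∈ range b, b ^ g := by simp
      _ ≤ _ := sum_le_sum h

lemma exists_outer_digits {b W : ℕ} (hb : 2 ≤ b) (hW : Odd W ∨ Even b) :
    ∃ y < b ^ 2, ((b ^ 2 - 1 : ℕ) : ℤ) ∣ 2 * y + 1 + b * W := by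
  set r := b ^ 2 - 1 with hr
  have h4 : 2 ^ 2 ≤ b ^ 2 := Nat.pow_le_pow_left hb 2
  have hr0 : (0 : ℤ) < r := by omega
  obtain ⟨u, k, hu⟩ : ∃ u k : ℤ, 1 + b * W + r * k = 2 * u := by
    rcases Nat.even_or_odd b with h | h
    · have h1 : Odd (1 + b * W) := (h.mul_right W).one_add
      have h2 : Odd r := by
        rw [hr, Nat.odd_sub (by omega)]
        simp [Nat.even_pow, h]
      obtain ⟨u, hu⟩ := h1.add_odd h2
      exact ⟨u, 1, by rw [mul_one]; exact_mod_cast (by omega : 1 + b * W + r = 2 * u)⟩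
    · have h1 : Odd W := hW.resolve_right (Nat.not_even_iff_odd.2 h)
      obtain ⟨u, hu⟩ := odd_one.add_odd (h.mul h1)
      exact ⟨u, 0, by rw [mul_zero, add_zero]; exact_mod_cast (by omega : 1 + b * W = 2 * u)⟩
  have h1 := Int.emod_nonneg (-u) hr0.ne'
  have h2 := Int.emod_lt_of_pos (-u) hr0
  refine ⟨((-u) % r).toNat, by omega, ?_⟩
  rw [Int.toNat_of_nonneg h1]
  have h3 := Int.emod_add_mul_ediv (-u) r
  exact ⟨-k - 2 * ((-u) / r), by linear_combination hu + 2 * h3⟩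

lemma le_card_goodPal {b x g : ℕ} (hb : 2 ≤ b) (hx : b ^ (2 * g + 7) ≤ x) :
    b ^ g ≤ (goodPal b x (2 * g + 7)).card := by
  have hb0 : 0 < b := by omega
  refine (le_card_oddPal hb g).trans ?_
  have hex : ∀ W : ℕ, ∃ y : ℕ, (Odd W ∨ Even b) → y < b ^ 2 ∧
      ((b ^ 2 - 1 : ℕ) : ℤ) ∣ 2 * y + 1 + b * W := by
    intro W
    by_cases h : Odd W ∨ Even b
    · obtain ⟨y, hy⟩ := exists_outer_digits hb h
      exact ⟨y, fun _ => hy⟩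
    · exact ⟨0, fun h1 => absurd h1 h⟩
  choose y hy using hex
  let n₂ : ℕ → ℕ := fun W => y W % b * (b ^ (2 * g + 1 + 1) + 1) + b * W
  let n₁ : ℕ → ℕ := fun W => y W / b * (b ^ (2 * g + 3 + 1) + 1) + b * n₂ W
  let n₀ : ℕ → ℕ := fun W => 1 * (b ^ (2 * g + 5 + 1) + 1) + b * n₁ W
  have hlt2 : ∀ W, y W % b < b := fun W => Nat.mod_lt _ hb0
  have hlt1 : ∀ W ∈ oddPal b g, y W / b < b := fun W hW => by
    rw [Nat.div_lt_iff_lt_mul hb0, ← sq]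
    exact (hy W (mem_filter.1 hW).2).1
  have hm2 : ∀ W ∈ oddPal b g, n₂ W ∈ pal b (2 * g + 3) := fun W hW =>
    mem_pal_add_two.2 ⟨_, W, hlt2 W, (mem_filter.1 hW).1, rfl⟩
  have hm1 : ∀ W ∈ oddPal b g, n₁ W ∈ pal b (2 * g + 5) := fun W hW =>
    mem_pal_add_two.2 ⟨_, _, hlt1 W hW, hm2 W hW, rfl⟩
  have hm0 : ∀ W ∈ oddPal b g, n₀ W ∈ pal b (2 * g + 7) := fun W hW =>
    mem_pal_add_two.2 ⟨1, _, by omega, hm1 W hW, rfl⟩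
  refine card_le_card_of_injOn n₀ (fun W hW => ?_) ?_
  · rw [mem_coe] at hW
    refine mem_coe.2 (mem_filter.2 ⟨hm0 W hW, (pal_lt (hm0 W hW)).le.trans hx, ?_⟩)
    rw [coprime_cube_sub_self]
    constructor
    · have : n₀ W = 1 + b * (b ^ (2 * g + 5) + n₁ W) := by
        simp only [n₀]; ring
      rw [this, Nat.coprime_add_mul_left_left]
      exact Nat.coprime_one_left b
    · rw [← Nat.isCoprime_iff_coprime]
      have hr : ((b ^ 2 - 1 : ℕ) : ℤ) = (b : ℤ) ^ 2 - 1 := by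
        rw [Nat.cast_sub (Nat.one_le_pow _ _ hb0)]; push_cast; ring
      have hdvd := (hy W (mem_filter.1 hW).2).2
      rw [hr] at hdvd ⊢
      have hpow : ∀ k : ℕ, ((b : ℤ) ^ 2 - 1) ∣ (b : ℤ) ^ (2 * k) - 1 := fun k => by
        rw [pow_mul]
        exact sub_one_dvd_pow_sub_one _ _
      obtain ⟨m, hm⟩ := hdvd
      obtain ⟨m1, hm1⟩ := hpow (g + 1)
      obtain ⟨m2, hm2⟩ := hpow (g + 2)
      obtain ⟨m3, hm3⟩ := hpow (g + 3)
      have hyd : (y W : ℤ) = (y W % b : ℕ) + b * (y W / b : ℕ) := by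
        exact_mod_cast (Nat.mod_add_div (y W) b).symm
      have key : ((n₀ W : ℕ) : ℤ) = 1 + ((b : ℤ) ^ 2 - 1) * (m3 + b * (y W / b : ℕ) * m2 +
          b ^ 2 * (y W % b : ℕ) * m1 + m + 2 * (y W % b : ℕ) + b * W) := by
        simp only [n₀, n₁, n₂]
        rw [hyd] at hm
        push_cast at hm ⊢
        linear_combination hm3 + (b : ℤ) * ((y W : ℤ) / (b : ℤ)) * hm2 +
          (b : ℤ) ^ 2 * ((y W : ℤ) % (b : ℤ)) * hm1 + hm
      rw [key]
      exact ⟨1, -(m3 + b * (y W / b : ℕ) * m2 +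
          b ^ 2 * (y W % b : ℕ) * m1 + m + 2 * (y W % b : ℕ) + b * W), by ring⟩
  · intro W hW W' hW' h
    rw [mem_coe] at hW hW'
    have h0 := (outer_injective (by omega) (by omega) (hm1 W hW) (hm1 W' hW') h).2
    have h1 := (outer_injective (hlt1 W hW) (hlt1 W' hW') (hm2 W hW) (hm2 W' hW') h0).2
    exact (outer_injective (hlt2 W) (hlt2 W') (mem_filter.1 hW).1 (mem_filter.1 hW').1 h1).2

lemma exists_le_sum_card_goodPal {b : ℕ} (hb : 2 ≤ b) : ∃ c : ℝ, 0 < c ∧ ∀ x N : ℕ,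
    b ^ N ≤ x → c * √b ^ (N + 1) ≤ ∑ M ∈ range (N + 2), ((goodPal b x M).card : ℝ) := by
  have hb2 : (2 : ℝ) ≤ b := by exact_mod_cast hb
  set β := √(b : ℝ) with hβ
  have hβ1 : 1 ≤ β := by rw [hβ, Real.one_le_sqrt]; linarith
  have hβ2 : β ^ 2 = b := Real.sq_sqrt (by linarith)
  refine ⟨(β ^ 9)⁻¹, by positivity, fun x N hx => ?_⟩
  rw [inv_mul_le_iff₀ (by positivity)]
  have hsingle : ∀ M < N + 2, ((goodPal b x M).card : ℝ) ≤
      ∑ M ∈ range (N + 2), ((goodPal b x M).card : ℝ) := fun M hM =>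
    single_le_sum (f := fun M => ((goodPal b x M).card : ℝ)) (fun _ _ => Nat.cast_nonneg _)
      (mem_range.2 hM)
  rcases lt_or_ge N 8 with hN | hN
  · have h1 : 1 ∈ goodPal b x 1 := by
      refine mem_filter.2 ⟨by simp [pal]; omega, ?_, Nat.coprime_one_left _⟩
      exact (Nat.one_le_pow _ _ (by omega)).trans hx
    have h2 : (1 : ℝ) ≤ (goodPal b x 1).card := by
      exact_mod_cast card_pos.2 ⟨1, h1⟩
    calc β ^ (N + 1) ≤ β ^ 9 := pow_le_pow_right₀ hβ1 (by omega)
      _ = β ^ 9 * 1 := (mul_one _).symm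
      _ ≤ _ := by gcongr; exact h2.trans (hsingle 1 (by omega))
  · have h1 := le_card_goodPal (x := x) (g := (N - 7) / 2) hb
      ((Nat.pow_le_pow_right (by omega) (by omega)).trans hx)
    calc β ^ (N + 1) ≤ β ^ (9 + 2 * ((N - 7) / 2)) := pow_le_pow_right₀ hβ1 (by omega)
      _ = β ^ 9 * (b : ℝ) ^ ((N - 7) / 2) := by rw [pow_add, pow_mul, hβ2]
      _ ≤ _ := by
        gcongr
        refine le_trans ?_ (hsingle (2 * ((N - 7) / 2) + 7) (by omega))
        exact_mod_cast h1
open ArithmeticFunction in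
lemma sum_moebius_sq_dvd {n D : ℕ} (hn : n ≠ 0) (hD : n < D ^ 2) :
    ∑ d ∈ (range D).filter fun d => d ^ 2 ∣ n, moebius d = if Squarefree n then 1 else 0 := by
  obtain ⟨a, m, ha, hm, rfl, hsq⟩ := Nat.sq_mul_squarefree_of_pos (Nat.pos_of_ne_zero hn)
  have hdvd : ∀ d, d ^ 2 ∣ m ^ 2 * a ↔ d ∣ m := by
    refine fun d => ⟨fun h => ?_, fun h => (pow_dvd_pow_of_dvd h 2).mul_right a⟩
    obtain ⟨g, d', m', hg, hco, rfl, rfl⟩ := Nat.exists_coprime' (Nat.gcd_pos_of_pos_right d hm)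
    rw [mul_pow, mul_pow, mul_right_comm] at h
    have h1 : d' ^ 2 ∣ a :=
      (hco.pow 2 2).dvd_of_dvd_mul_left (Nat.dvd_of_mul_dvd_mul_right (pow_pos hg 2) h)
    have h2 : d' = 1 := Nat.isUnit_iff.1 (hsq d' (by rwa [← sq]))
    rw [h2, one_mul]
    exact dvd_mul_left _ _
  have hset : (range D).filter (fun d => d ^ 2 ∣ m ^ 2 * a) = m.divisors := by
    ext d
    rw [mem_filter, mem_range, hdvd, Nat.mem_divisors]
    refine ⟨fun h => ⟨h.2, hm.ne'⟩, fun h => ⟨?_, h.1⟩⟩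
    have h1 : d ≤ m := Nat.le_of_dvd hm h.1
    have h2 : m ^ 2 < D ^ 2 := (Nat.le_mul_of_pos_right _ ha).trans_lt hD
    exact h1.trans_lt (lt_of_pow_lt_pow_left₀ 2 (Nat.zero_le _) h2)
  have hiff : Squarefree (m ^ 2 * a) ↔ m = 1 := by
    constructor
    · intro h
      exact Nat.isUnit_iff.1 (h m (by rw [← sq]; exact dvd_mul_right _ _))
    · rintro rfl
      simpa using hsq
  rw [hset, ← coe_mul_zeta_apply, moebius_mul_coe_zeta, one_apply]
  simp only [hiff]

/-- The terms of the series `∑ μ(d) / d²` over `d` coprime to `B`. -/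
noncomputable def moebiusTerm (B d : ℕ) : ℝ :=
  if d.Coprime B then (ArithmeticFunction.moebius d : ℝ) / (d : ℝ) ^ 2 else 0

lemma abs_moebiusTerm_le (B d : ℕ) : |moebiusTerm B d| ≤ ((d : ℝ) ^ 2)⁻¹ := by
  rw [moebiusTerm]
  split_ifs
  · rw [abs_div, abs_of_nonneg (sq_nonneg (d : ℝ)), div_eq_mul_inv]
    refine mul_le_of_le_one_left (by positivity) ?_
    exact_mod_cast ArithmeticFunction.abs_moebius_le_one
  · rw [abs_zero]
    positivity

lemma summable_moebiusTerm (B : ℕ) : Summable (moebiusTerm B) :=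
  .of_norm_bounded (Real.summable_nat_pow_inv.2 one_lt_two) (abs_moebiusTerm_le B)

lemma tsum_moebiusTerm {B : ℕ} (hB : B ≠ 0) : ∑' d, moebiusTerm B d =
    (∑' n : ℕ, (1 : ℝ) / (n + 1) ^ 2)⁻¹ * ∏ p ∈ B.primeFactors, (1 - 1 / (p : ℝ) ^ 2)⁻¹ := by
  have : NeZero B := ⟨hB⟩
  have h2 : (1 : ℝ) < (2 : ℂ).re := by norm_num
  have hmul := DirichletCharacter.LSeries.mul_mu_eq_one (1 : DirichletCharacter ℂ B) h2
  have hchi : LSeries (fun n => (1 : DirichletCharacter ℂ B) n) 2 =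
      (((∏ p ∈ B.primeFactors, (1 - 1 / (p : ℝ) ^ 2)) * ∑' n : ℕ, (1 : ℝ) / (n + 1) ^ 2 : ℝ) : ℂ) := by
    rw [← DirichletCharacter.LFunction_eq_LSeries _ h2]
    refine (DirichletCharacter.LFunctionTrivChar_eq_mul_riemannZeta (by norm_num)).trans ?_
    rw [zeta_eq_tsum_one_div_nat_add_one_cpow h2]
    push_cast
    congr 1
    · refine prod_congr rfl fun p _ => ?_
      rw [Complex.cpow_neg, one_div]
      norm_cast
    · refine tsum_congr fun n => ?_
      norm_cast
  have hmu : LSeries ((fun n : ℕ => (1 : DirichletCharacter ℂ B) n) *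
      fun n : ℕ => (ArithmeticFunction.moebius n : ℂ)) 2 = ((∑' d, moebiusTerm B d : ℝ) : ℂ) := by
    rw [LSeries, Complex.ofReal_tsum]
    refine tsum_congr fun d => ?_
    rcases eq_or_ne d 0 with rfl | hd
    · simp [moebiusTerm]
    · rw [LSeries.term_of_ne_zero hd, Pi.mul_apply, moebiusTerm]
      split_ifs with h
      · rw [MulChar.one_apply ((ZMod.isUnit_iff_coprime d B).2 h)]
        push_cast
        norm_cast
        simp
      · rw [MulChar.map_nonunit _ (fun h1 => h ((ZMod.isUnit_iff_coprime d B).1 h1))]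
        simp
  rw [hchi, hmu] at hmul
  have hreal : ((∏ p ∈ B.primeFactors, (1 - 1 / (p : ℝ) ^ 2)) * ∑' n : ℕ, (1 : ℝ) / (n + 1) ^ 2) *
      ∑' d, moebiusTerm B d = 1 := by exact_mod_cast hmul
  rw [prod_inv_distrib, ← mul_inv, mul_comm _ (∏ p ∈ B.primeFactors, _)]
  exact eq_inv_of_mul_eq_one_right hreal

lemma abs_sum_moebiusTerm_sub_tsum_le (B : ℕ) {D : ℕ} (hD : 0 < D) :
    |∑ d ∈ range D, moebiusTerm B d - ∑' d, moebiusTerm B d| ≤ 2 / D := by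
  have htend := ((summable_moebiusTerm B).hasSum.tendsto_sum_nat.const_sub
    (∑ d ∈ range D, moebiusTerm B d)).abs
  refine le_of_tendsto htend ?_
  filter_upwards [Filter.eventually_ge_atTop D] with E hE
  rw [abs_sub_comm, ← sum_Ico_eq_sub _ hE]
  calc |∑ d ∈ Ico D E, moebiusTerm B d| ≤ ∑ d ∈ Ico D E, |moebiusTerm B d| :=
        abs_sum_le_sum_abs _ _
    _ ≤ ∑ d ∈ Ico D E, ((d : ℝ) ^ 2)⁻¹ := sum_le_sum fun d _ => abs_moebiusTerm_le B d
    _ = ∑ d ∈ Ioo (D - 1) E, ((d : ℝ) ^ 2)⁻¹ := by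
      congr 1
      ext d
      simp only [mem_Ico, mem_Ioo]
      omega
    _ ≤ 2 / ((D - 1 : ℕ) + 1) := sum_Ioo_inv_sq_le _ _
    _ = 2 / D := by
      rw [Nat.cast_sub hD]
      norm_num
lemma cube_sub_self_ne_one {b : ℕ} (hb : 2 ≤ b) : b ^ 3 - b ≠ 0 ∧ b ^ 3 - b ≠ 1 := by
  have h : b * 2 ^ 2 ≤ b * b ^ 2 := Nat.mul_le_mul_left b (Nat.pow_le_pow_left hb 2)
  have h1 : b ^ 3 = b * b ^ 2 := by ring
  omega

lemma not_dvd_of_mem_goodPal {b x N n : ℕ} (hb : 2 ≤ b) (h : n ∈ goodPal b x N) : ¬ b ∣ n := by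
  intro h1
  have h2 := (coprime_cube_sub_self.1 (mem_filter.1 h).2.2).1
  have := Nat.eq_one_of_dvd_coprimes h2 h1 dvd_rfl
  omega

lemma ne_zero_of_mem_goodPal {b x N n : ℕ} (hb : 2 ≤ b) (h : n ∈ goodPal b x N) : n ≠ 0 := by
  rintro rfl
  exact not_dvd_of_mem_goodPal hb h (dvd_zero b)

lemma ncard_pstarSet_inter {b N : ℕ} {x : ℝ} (hb : 2 ≤ b) (hx : 0 ≤ x) (hN : ⌊x⌋₊ < b ^ (N + 1))
    (p : ℕ → Prop) [DecidablePred p] : {n | n ∈ PstarSet b x ∧ p n}.ncard =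
      ∑ M ∈ range (N + 2), ((goodPal b ⌊x⌋₊ M).filter p).card := by
  have hset : {n | n ∈ PstarSet b x ∧ p n} =
      ((range (N + 2)).biUnion fun M => (goodPal b ⌊x⌋₊ M).filter p : Finset ℕ) := by
    ext n
    simp only [Set.mem_ofPred_eq, mem_coe, mem_biUnion, mem_filter]
    constructor
    · rintro ⟨⟨h0, h1, ⟨-, h3⟩, h4⟩, h5⟩
      have h6 : n ≤ ⌊x⌋₊ := Nat.le_floor h1
      refine ⟨(b.digits n).length, mem_range.2 ?_, mem_filter.2
        ⟨mem_pal_of_palindrome hb h3, h6, h4⟩, h5⟩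
      have := (Nat.digits_length_le_iff (k := N + 1) (by omega) n).2 (h6.trans_lt hN)
      omega
    · rintro ⟨M, -, h1, h2⟩
      have h3 := not_dvd_of_mem_goodPal hb h1
      have h4 := mem_filter.1 h1
      exact ⟨⟨Nat.pos_of_ne_zero (ne_zero_of_mem_goodPal hb h1), (Nat.le_floor_iff hx).1 h4.2.1,
        ⟨h3, (digits_of_mem_pal hb h4.1 h3).1⟩, h4.2.2⟩, h2⟩
  rw [hset, Set.ncard_coe_finset, card_biUnion]
  intro M _ M' _ hne
  refine disjoint_left.2 fun n h1 h2 => hne ?_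
  have h1 := (mem_filter.1 h1).1
  have h2 := (mem_filter.1 h2).1
  have h3 := not_dvd_of_mem_goodPal hb h1
  rw [← (digits_of_mem_pal hb (mem_filter.1 h1).1 h3).2,
    (digits_of_mem_pal hb (mem_filter.1 h2).1 h3).2]
lemma ite_squarefree_eq_sum {b x N M n : ℕ} (hb : 2 ≤ b) (hx : x < b ^ N)
    (hn : n ∈ goodPal b x M) : (if Squarefree n then (1 : ℝ) else 0) =
      ∑ d ∈ (range (b ^ N)).filter (fun d => d.Coprime (b ^ 3 - b)),
        (ArithmeticFunction.moebius d : ℝ) * (if d ^ 2 ∣ n then 1 else 0) := by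
  have hn' := mem_filter.1 hn
  have hD : n < (b ^ N) ^ 2 := by
    have h1 : 1 ≤ b ^ N := Nat.one_le_pow _ _ (by omega)
    have h2 : b ^ N * 1 ≤ b ^ N * b ^ N := Nat.mul_le_mul_left _ h1
    rw [sq]
    omega
  have h := sum_moebius_sq_dvd (ne_zero_of_mem_goodPal hb hn) hD
  have h' : (if Squarefree n then (1 : ℝ) else 0) =
      ∑ d ∈ (range (b ^ N)).filter fun d => d ^ 2 ∣ n, (ArithmeticFunction.moebius d : ℝ) := by
    rw [← Int.cast_sum, h]
    split_ifs <;> simp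
  simp_rw [h', mul_ite, mul_one, mul_zero, ← sum_filter, filter_filter]
  refine sum_congr (filter_congr fun d _ => ?_) fun _ _ => rfl
  refine ⟨fun h1 => ⟨?_, h1⟩, fun h1 => h1.2⟩
  exact Nat.Coprime.coprime_dvd_left ((dvd_pow_self d two_ne_zero).trans h1) hn'.2.2

/-- Splitting the Möbius sum at `b ^ j`. -/
lemma abs_card_squarefree_sub_le {b x N j : ℕ} (hb : 2 ≤ b) (hx : x < b ^ N) (hj : j ≤ N) :
    |∑ M ∈ range (N + 1), (((goodPal b x M).filter Squarefree).card : ℝ) -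
      (∑ M ∈ range (N + 1), ((goodPal b x M).card : ℝ)) *
        ∑ d ∈ range (b ^ j), moebiusTerm (b ^ 3 - b) d| ≤
    ∑ d ∈ (range (b ^ j)).filter (fun d => d.Coprime (b ^ 3 - b)),
      |∑ M ∈ range (N + 1), ∑ n ∈ goodPal b x M,
        ((if d ^ 2 ∣ n then (1 : ℝ) else 0) - 1 / (d ^ 2 : ℕ))| +
    ∑ M ∈ range (N + 1), ∑ d ∈ (Ico (b ^ j) (b ^ N)).filter (fun d => d.Coprime b),
      ((palSq b M d).card : ℝ) := by
  set B := b ^ 3 - b with hB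
  set G : ℕ → ℝ := fun d => ∑ M ∈ range (N + 1), ∑ n ∈ goodPal b x M,
    (if d ^ 2 ∣ n then (1 : ℝ) else 0) with hG
  set P := ∑ M ∈ range (N + 1), ((goodPal b x M).card : ℝ) with hP
  have hS : ∑ M ∈ range (N + 1), (((goodPal b x M).filter Squarefree).card : ℝ) =
      ∑ d ∈ (range (b ^ N)).filter (fun d => d.Coprime B),
        (ArithmeticFunction.moebius d : ℝ) * G d := by
    simp only [card_filter, hG, mul_sum, Nat.cast_sum, Nat.cast_ite, Nat.cast_one, Nat.cast_zero]
    rw [sum_comm]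
    refine sum_congr rfl fun M _ => ?_
    rw [sum_comm]
    exact sum_congr rfl fun n hn => ite_squarefree_eq_sum hb hx hn
  have hsplit : (range (b ^ N)).filter (fun d => d.Coprime B) =
      (range (b ^ j)).filter (fun d => d.Coprime B) ∪
        (Ico (b ^ j) (b ^ N)).filter (fun d => d.Coprime B) := by
    rw [← filter_union, range_eq_Ico, range_eq_Ico,
      Ico_union_Ico_eq_Ico (Nat.zero_le _) (Nat.pow_le_pow_right (by omega) hj)]
  have hdisj : Disjoint ((range (b ^ j)).filter (fun d => d.Coprime B))
      ((Ico (b ^ j) (b ^ N)).filter (fun d => d.Coprime B)) := by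
    refine disjoint_left.2 fun d h1 h2 => ?_
    have h1 := mem_range.1 (mem_filter.1 h1).1
    have h2 := (mem_Ico.1 (mem_filter.1 h2).1).1
    omega
  have hmu : ∀ d, |(ArithmeticFunction.moebius d : ℝ)| ≤ 1 := fun d => by
    exact_mod_cast ArithmeticFunction.abs_moebius_le_one
  have hmain : P * ∑ d ∈ range (b ^ j), moebiusTerm B d =
      ∑ d ∈ (range (b ^ j)).filter (fun d => d.Coprime B),
        (ArithmeticFunction.moebius d : ℝ) * (P * (1 / (d ^ 2 : ℕ))) := by
    simp only [moebiusTerm]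
    rw [← sum_filter, mul_sum]
    refine sum_congr rfl fun d _ => ?_
    push_cast
    ring
  have herr : ∀ d, ∑ M ∈ range (N + 1), ∑ n ∈ goodPal b x M,
      ((if d ^ 2 ∣ n then (1 : ℝ) else 0) - 1 / (d ^ 2 : ℕ)) = G d - P * (1 / (d ^ 2 : ℕ)) := by
    intro d
    simp only [hG, hP, sum_sub_distrib, sum_const, nsmul_eq_mul, sum_mul]
  rw [hS, hsplit, sum_union hdisj, hmain, add_sub_right_comm, ← sum_sub_distrib]
  refine (abs_add_le _ _).trans (add_le_add ?_ ?_)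
  · refine (abs_sum_le_sum_abs _ _).trans (sum_le_sum fun d _ => ?_)
    rw [herr, ← mul_sub, abs_mul]
    exact mul_le_of_le_one_left (abs_nonneg _) (hmu d)
  · rw [sum_comm]
    refine (abs_sum_le_sum_abs _ _).trans ?_
    have hG0 : ∀ d, 0 ≤ G d := fun d =>
      sum_nonneg fun _ _ => sum_nonneg fun _ _ => by split_ifs <;> norm_num
    have hGd : ∀ d, G d ≤ ∑ M ∈ range (N + 1), ((palSq b M d).card : ℝ) := by
      intro d
      refine sum_le_sum fun M _ => ?_
      rw [← sum_filter, sum_const, nsmul_eq_mul, mul_one, Nat.cast_le]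
      refine card_le_card fun n hn => ?_
      have hn := mem_filter.1 hn
      exact mem_filter.2 ⟨(mem_filter.1 hn.1).1, ne_zero_of_mem_goodPal hb hn.1, hn.2⟩
    calc ∑ d ∈ (Ico (b ^ j) (b ^ N)).filter (fun d => d.Coprime B),
          |(ArithmeticFunction.moebius d : ℝ) * G d|
        ≤ ∑ d ∈ (Ico (b ^ j) (b ^ N)).filter (fun d => d.Coprime B), G d := by
          refine sum_le_sum fun d _ => ?_
          rw [abs_mul, abs_of_nonneg (hG0 d)]
          exact mul_le_of_le_one_left (hG0 d) (hmu d)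
      _ ≤ ∑ d ∈ (Ico (b ^ j) (b ^ N)).filter (fun d => d.Coprime b), G d :=
          sum_le_sum_of_subset_of_nonneg
            (monotone_filter_right _ fun d _ h => (coprime_cube_sub_self.1 h).1) fun d _ _ => hG0 d
      _ ≤ _ := sum_le_sum fun d _ => hGd d

lemma natCast_le_pow_three_halves (b j : ℕ) {d : ℕ} (hd : d < b ^ j) :
    ((d ^ 2 : ℕ) : ℝ) ≤ (3 / 2) ^ (4 * b * j) := by
  have h1 : (b : ℝ) ≤ (3 / 2) ^ (2 * b) := by
    have := one_add_mul_le_pow (a := (1 / 2 : ℝ)) (by norm_num) (2 * b)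
    push_cast at this
    norm_num at this ⊢
    linarith
  have h2 : (d : ℝ) ≤ (b : ℝ) ^ j := by exact_mod_cast hd.le
  calc ((d ^ 2 : ℕ) : ℝ) = (d : ℝ) ^ 2 := by push_cast; ring
    _ ≤ (((3 / 2 : ℝ) ^ (2 * b)) ^ j) ^ 2 := by
      gcongr
      exact h2.trans (by gcongr)
    _ = _ := by
      rw [← pow_mul, ← pow_mul]
      congr 1
      ring

lemma exists_abs_card_squarefree_sub_le {b : ℕ} (hb : 2 ≤ b) : ∃ (K κ : ℝ) (Y : ℕ),
    0 < K ∧ 0 < κ ∧ κ < 1 ∧ 0 < Y ∧ ∀ x N : ℕ, b ^ N ≤ x → x < b ^ (N + 1) →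
    |∑ M ∈ range (N + 2), (((goodPal b x M).filter Squarefree).card : ℝ) -
      (∑ M ∈ range (N + 2), ((goodPal b x M).card : ℝ)) * ∑' d, moebiusTerm (b ^ 3 - b) d| ≤
    K * (∑ M ∈ range (N + 2), ((goodPal b x M).card : ℝ)) * κ ^ Nat.sqrt ((N + 1) / Y) := by
  obtain ⟨C₁, hC₁, hmain⟩ := exists_abs_sum_sum_goodPal_le hb
  obtain ⟨C₂, κ, hC₂, hκ0, hκ1, htail⟩ := exists_sum_sum_card_palSq_le hb
  obtain ⟨c, hc, hlow⟩ := exists_le_sum_card_goodPal hb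
  have hb2 : (2 : ℝ) ≤ b := by exact_mod_cast hb
  have hbb : (b : ℝ) * (1 / (2 * b)) = 1 / 2 := by field_simp
  have hs9 := le_saving hb
  have hs1 := saving_lt_one hb
  obtain ⟨E, hE⟩ := exists_pow_lt_of_lt_one (show (0 : ℝ) < 1 / (2 * b) by positivity) hs1
  have hE0 : 0 < E := by
    rcases Nat.eq_zero_or_pos E with rfl | h
    · exfalso
      rw [pow_zero, lt_div_iff₀ (by positivity)] at hE
      linarith
    · exact h
  refine ⟨C₁ / c + C₂ / c + 2, max κ (1 / 2), (16 * b + 8) * E, by positivity, by positivity,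
    max_lt hκ1 (by norm_num), by positivity, fun x N hx hxN => ?_⟩
  set Y := (16 * b + 8) * E with hY
  set j := Nat.sqrt ((N + 1) / Y) with hj
  set β := √(b : ℝ) with hβ
  set P := ∑ M ∈ range (N + 2), ((goodPal b x M).card : ℝ) with hP
  set κ' := max κ (1 / 2) with hκ'
  have hP0 : 0 ≤ P := sum_nonneg fun _ _ => Nat.cast_nonneg _
  have hjN : Y * j ^ 2 ≤ N + 1 :=
    (Nat.mul_le_mul_left _ (Nat.sqrt_le' _)).trans (Nat.mul_div_le _ _)
  have hjle : j ≤ N + 1 := (Nat.sqrt_le_self _).trans (Nat.div_le_self _ _)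
  have hβP : β ^ (N + 1) ≤ P / c := by
    rw [le_div_iff₀ hc, mul_comm]
    exact hlow x N hx
  have hbound := abs_card_squarefree_sub_le hb hxN hjle
  change |_ - P * _| ≤ _ at hbound
  have hκl : κ ≤ κ' := le_max_left _ _
  have hκr : 1 / 2 ≤ κ' := le_max_right _ _
  clear_value j κ' P Y
  have hexp : E * j ≤ (N + 1) / 4 / (4 * b * j + 2) := by
    rw [Nat.div_div_eq_div_mul, Nat.le_div_iff_mul_le (by positivity)]
    refine le_trans ?_ hjN
    rw [hY]
    calc E * j * (4 * (4 * b * j + 2)) = 16 * b * E * j ^ 2 + 8 * E * j := by ring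
      _ ≤ 16 * b * E * j ^ 2 + 8 * E * j ^ 2 := by
        gcongr
        exact Nat.le_self_pow two_ne_zero j
      _ = (16 * b + 8) * E * j ^ 2 := by ring
  have hsav : saving b ^ ((N + 1) / 4 / (4 * b * j + 2)) ≤ (1 / (2 * b)) ^ j :=
    calc saving b ^ ((N + 1) / 4 / (4 * b * j + 2)) ≤ saving b ^ (E * j) :=
          pow_le_pow_of_le_one (by linarith) hs1.le hexp
      _ = (saving b ^ E) ^ j := pow_mul _ _ _
      _ ≤ _ := by gcongr
  have hsmall : ∑ d ∈ (range (b ^ j)).filter (fun d => d.Coprime (b ^ 3 - b)),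
      |∑ M ∈ range (N + 1 + 1), ∑ n ∈ goodPal b x M,
        ((if d ^ 2 ∣ n then (1 : ℝ) else 0) - 1 / (d ^ 2 : ℕ))| ≤ C₁ / c * P * κ' ^ j := by
    have h1 : ∀ d ∈ (range (b ^ j)).filter (fun d => d.Coprime (b ^ 3 - b)),
        |∑ M ∈ range (N + 1 + 1), ∑ n ∈ goodPal b x M,
          ((if d ^ 2 ∣ n then (1 : ℝ) else 0) - 1 / (d ^ 2 : ℕ))| ≤
          C₁ * (P / c) * (1 / (2 * b)) ^ j := by
      intro d hd
      have hd := mem_filter.1 hd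
      have hd0 : d ≠ 0 := by
        rintro rfl
        exact (cube_sub_self_ne_one hb).2 ((Nat.coprime_zero_left _).1 hd.2)
      refine (hmain (d ^ 2) (4 * b * j) x (N + 1) (by positivity) (hd.2.pow_left 2)
        (natCast_le_pow_three_halves b j (mem_range.1 hd.1))).trans ?_
      exact mul_le_mul (mul_le_mul_of_nonneg_left hβP hC₁.le) hsav
        (pow_nonneg (by linarith) _) (mul_nonneg hC₁.le (div_nonneg hP0 hc.le))
    refine (sum_le_card_nsmul _ _ _ h1).trans ?_
    rw [nsmul_eq_mul]
    have h2 : (((range (b ^ j)).filter (fun d => d.Coprime (b ^ 3 - b))).card : ℝ) ≤ (b : ℝ) ^ j := by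
      exact_mod_cast (card_filter_le _ _).trans (card_range _).le
    calc _ ≤ (b : ℝ) ^ j * (C₁ * (P / c) * (1 / (2 * b)) ^ j) := by gcongr
      _ = C₁ / c * P * (b * (1 / (2 * b))) ^ j := by rw [mul_pow]; ring
      _ = C₁ / c * P * (1 / 2) ^ j := by rw [hbb]
      _ ≤ _ := by gcongr
  have hlarge : ∑ M ∈ range (N + 1 + 1),
      ∑ d ∈ (Ico (b ^ j) (b ^ (N + 1))).filter (fun d => d.Coprime b),
      ((palSq b M d).card : ℝ) ≤ C₂ / c * P * κ' ^ j := by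
    refine (htail (N + 1) j (N + 1)).trans ?_
    calc C₂ * β ^ (N + 1) * κ ^ j ≤ C₂ * (P / c) * κ' ^ j := by
          gcongr
      _ = _ := by ring
  have hseries : |P * ∑ d ∈ range (b ^ j), moebiusTerm (b ^ 3 - b) d -
      P * ∑' d, moebiusTerm (b ^ 3 - b) d| ≤ 2 * P * κ' ^ j := by
    rw [← mul_sub, abs_mul, abs_of_nonneg hP0]
    have h1 := abs_sum_moebiusTerm_sub_tsum_le (b ^ 3 - b) (D := b ^ j)
      (Nat.pow_pos (by omega))
    have h2 : 2 / ((b ^ j : ℕ) : ℝ) ≤ 2 * (1 / 2) ^ j := by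
      rw [div_eq_mul_inv, Nat.cast_pow, ← inv_pow, one_div]
      gcongr
    calc _ ≤ P * (2 * κ' ^ j) := by
          gcongr
          refine h1.trans (h2.trans ?_)
          gcongr
      _ = _ := by ring
  calc _ ≤ _ := abs_sub_le _ (P * ∑ d ∈ range (b ^ j), moebiusTerm (b ^ 3 - b) d) _
    _ ≤ (C₁ / c * P * κ' ^ j + C₂ / c * P * κ' ^ j) + 2 * P * κ' ^ j :=
      add_le_add (hbound.trans (add_le_add hsmall hlarge)) hseries
    _ = _ := by ring

lemma exists_add_one_pow_mul_pow_le {κ : ℝ} (h0 : 0 < κ) (h1 : κ < 1) (k : ℕ) :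
    ∃ K : ℝ, 0 < K ∧ ∀ j : ℕ, ((j : ℝ) + 1) ^ k * κ ^ j ≤ K := by
  obtain ⟨K, hK⟩ := (tendsto_pow_const_mul_const_pow_of_abs_lt_one k
    (show |κ| < 1 by rwa [abs_of_pos h0])).bddAbove_range
  refine ⟨max (K / κ) 1, by positivity, fun j => le_max_of_le_left ?_⟩
  rw [le_div_iff₀ h0]
  have := hK ⟨j + 1, rfl⟩
  simp only [Nat.cast_add, Nat.cast_one, pow_succ κ] at this
  linarith

lemma log_rpow_le {b N Y : ℕ} {x A : ℝ} (hb : 2 ≤ b) (hY : 0 < Y) (hx : 2 ≤ x)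
    (hA : 0 < A) (hxN : ⌊x⌋₊ < b ^ (N + 1)) {k : ℕ} (hk : A ≤ k) :
    Real.log x ^ A ≤
      ((b : ℝ) * Y) ^ k * (((Nat.sqrt ((N + 1) / Y) : ℕ) : ℝ) + 1) ^ (2 * k) := by
  set j := Nat.sqrt ((N + 1) / Y) with hj
  have hlog0 : 0 ≤ Real.log x := Real.log_nonneg (by linarith)
  have hb2 : (2 : ℝ) ≤ b := by exact_mod_cast hb
  have hY1 : (1 : ℝ) ≤ Y := by exact_mod_cast hY
  have hNj : N + 1 ≤ Y * (j + 1) ^ 2 := by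
    have h1 : (N + 1) / Y < (j + 1) ^ 2 := Nat.lt_succ_sqrt' _
    rw [Nat.div_lt_iff_lt_mul hY, mul_comm] at h1
    exact h1.le
  have hNj' : (N : ℝ) + 1 ≤ Y * ((j : ℝ) + 1) ^ 2 := by exact_mod_cast hNj
  have hxb : x ≤ (b : ℝ) ^ (N + 1) := by
    have h1 : (⌊x⌋₊ : ℝ) + 1 ≤ (b : ℝ) ^ (N + 1) := by exact_mod_cast hxN
    exact (Nat.lt_floor_add_one x).le.trans h1
  have hlog : Real.log x ≤ b * Y * ((j : ℝ) + 1) ^ 2 :=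
    calc Real.log x ≤ Real.log ((b : ℝ) ^ (N + 1)) := Real.log_le_log (by linarith) hxb
      _ = (N + 1) * Real.log b := by rw [Real.log_pow]; push_cast; ring
      _ ≤ (Y * ((j : ℝ) + 1) ^ 2) * b := by
        gcongr
        exact Real.log_le_self (by linarith)
      _ = _ := by ring
  have hone : 1 ≤ b * Y * ((j : ℝ) + 1) ^ 2 := by
    have h1 : (1 : ℝ) ≤ ((j : ℝ) + 1) ^ 2 := one_le_pow₀ (by linarith [(Nat.cast_nonneg j : (0 : ℝ) ≤ j)])
    have h2 : (1 : ℝ) ≤ b * Y := one_le_mul_of_one_le_of_one_le (by linarith) hY1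
    exact one_le_mul_of_one_le_of_one_le h2 h1
  calc Real.log x ^ A ≤ (b * Y * ((j : ℝ) + 1) ^ 2) ^ A := Real.rpow_le_rpow hlog0 hlog hA.le
    _ ≤ (b * Y * ((j : ℝ) + 1) ^ 2) ^ (k : ℝ) := Real.rpow_le_rpow_of_exponent_le hone hk
    _ = _ := by rw [Real.rpow_natCast, mul_pow, ← pow_mul]
end SquarefreePalindromes

open SquarefreePalindromes

/-- For every `A > 0`,
`Q*_b(x) = (#𝒫*_b(x)/ζ(2)) ∏_{p ∣ b³−b} (1 − 1/p²)⁻¹ (1 + O_{b,A}((log x)^{-A}))`,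
where `ζ(2) = ∑_{n ≥ 1} 1/n²`. -/
theorem squarefree_palindromes_asymptotic (b : ℕ) (hb : 2 ≤ b) (A : ℝ) (hA : 0 < A) :
    ∃ C : ℝ, 0 < C ∧ ∀ x : ℝ, 2 ≤ x →
      |(QstarCount b x : ℝ) -
        ((PstarSet b x).ncard : ℝ) / (∑' n : ℕ, (1 : ℝ) / (n + 1) ^ 2) *
          ∏ p ∈ (b ^ 3 - b).primeFactors, (1 - 1 / (p : ℝ) ^ 2)⁻¹| ≤
      C * ((PstarSet b x).ncard : ℝ) / (Real.log x) ^ A := by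
  obtain ⟨K, κ, Y, hK, hκ0, hκ1, hY, hmain⟩ := exists_abs_card_squarefree_sub_le hb
  obtain ⟨k, hk⟩ := exists_nat_ge A
  obtain ⟨K', hK', hdecay⟩ := exists_add_one_pow_mul_pow_le hκ0 hκ1 (2 * k)
  have hbY : (0 : ℝ) < ((b : ℝ) * Y) ^ k := by
    have : 0 < b * Y := by positivity
    exact pow_pos (by exact_mod_cast this) k
  refine ⟨K * (((b : ℝ) * Y) ^ k * K'), by positivity, fun x hx => ?_⟩
  have hX0 : ⌊x⌋₊ ≠ 0 := (Nat.floor_pos.2 (by linarith)).ne'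
  set N := Nat.log b ⌊x⌋₊ with hN
  have hle : b ^ N ≤ ⌊x⌋₊ := Nat.pow_log_le_self b hX0
  have hlt : ⌊x⌋₊ < b ^ (N + 1) := Nat.lt_pow_succ_log_self hb _
  have hQ := ncard_pstarSet_inter hb (by linarith : 0 ≤ x) hlt Squarefree
  have hP := ncard_pstarSet_inter hb (by linarith : 0 ≤ x) hlt fun _ => True
  simp only [and_true, Set.ofPred_mem_eq, Finset.filter_true] at hP
  have h := hmain ⌊x⌋₊ N hle hlt
  rw [tsum_moebiusTerm (cube_sub_self_ne_one hb).1, ← Nat.cast_sum, ← Nat.cast_sum, ← hQ, ← hP,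
    ← mul_assoc, ← div_eq_mul_inv] at h
  refine h.trans ?_
  have hlog : 0 < Real.log x ^ A := Real.rpow_pos_of_pos (Real.log_pos (by linarith)) A
  rw [le_div_iff₀ hlog]
  have hlog' := log_rpow_le hb hY hx hA hlt hk
  set j := Nat.sqrt ((N + 1) / Y)
  set P := ((PstarSet b x).ncard : ℝ)
  calc K * P * κ ^ j * Real.log x ^ A
      ≤ K * P * κ ^ j * (((b : ℝ) * Y) ^ k * ((j : ℝ) + 1) ^ (2 * k)) := by gcongr
    _ = K * P * ((b : ℝ) * Y) ^ k * (((j : ℝ) + 1) ^ (2 * k) * κ ^ j) := by ring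
    _ ≤ K * P * ((b : ℝ) * Y) ^ k * K' := by gcongr; exact hdecay j
    _ = _ := by ring
end

section
/- For all b ≥ 2, x ≥ 1 and D ≥ 1, S_b(x,D) ≪_b x / D^{3/2}, i.e. there is a constant C depending only on b with S_b(x,D) ≤ C x / D^{3/2}. -/
/-- `S_b(x, D)`: the number of `n ∈ 𝒫*_b(x)` divisible by `d²` for some
integer `d` with `D ≤ d ≤ 2D`. -/
noncomputable def Scount (b : ℕ) (x D : ℝ) : ℕ :=
  {n : ℕ | n ∈ PstarSet b x ∧ ∃ d : ℕ, D ≤ (d : ℝ) ∧ (d : ℝ) ≤ 2 * D ∧ d ^ 2 ∣ n}.ncard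

theorem prime_pow_dvd_two_mul_or_of_dvd_mul {p : ℕ} (hp : p.Prime) (a : ℕ) {u v d : ℤ}
    (hd : ¬ (p : ℤ) ∣ d) (huv : u + v = 2 * d) (h : (p : ℤ) ^ a ∣ u * v) :
    (p : ℤ) ^ a ∣ 2 * u ∨ (p : ℤ) ^ a ∣ 2 * v := by
  have hpi : Prime (p : ℤ) := Nat.prime_iff_prime_int.mp hp
  by_cases hu : (p : ℤ) ∣ u
  · by_cases hv : (p : ℤ) ∣ v
    · have h2d : (p : ℤ) ∣ 2 * d := huv ▸ dvd_add hu hv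
      have h2 : (p : ℤ) ∣ 2 := (hpi.dvd_or_dvd h2d).resolve_right hd
      have hp2 : p = 2 := (Nat.prime_dvd_prime_iff_eq hp Nat.prime_two).mp (by exact_mod_cast h2)
      subst hp2
      obtain ⟨u', rfl⟩ := hu
      obtain ⟨v', rfl⟩ := hv
      push_cast at *
      by_cases hu' : (2 : ℤ) ∣ u'
      · have hv' : ¬ (2 : ℤ) ∣ v' := by omega
        left
        refine (hpi.coprime_iff_not_dvd.mpr hv').pow_left.dvd_of_dvd_mul_right ?_
        rwa [show 2 * (2 * u') * v' = 2 * u' * (2 * v') by ring]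
      · right
        refine (hpi.coprime_iff_not_dvd.mpr hu').pow_left.dvd_of_dvd_mul_right ?_
        rwa [show 2 * (2 * v') * u' = 2 * u' * (2 * v') by ring]
    · left
      exact ((hpi.coprime_iff_not_dvd.mpr hv).pow_left.dvd_of_dvd_mul_right h).mul_left 2
  · right
    exact ((hpi.coprime_iff_not_dvd.mpr hu).pow_left.dvd_of_dvd_mul_left h).mul_left 2

theorem pow_dvd_of_forall_primeFactors {b k : ℕ} (hb : b ≠ 0) {z : ℤ}
    (h : ∀ p ∈ b.primeFactors, ((p ^ (b ^ k).factorization p : ℕ) : ℤ) ∣ z) :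
    ((b ^ k : ℕ) : ℤ) ∣ z := by
  rw [Int.natCast_dvd, Nat.dvd_iff_prime_pow_dvd_dvd]
  intro p j hp hj
  rcases Nat.eq_zero_or_pos j with rfl | hjpos
  · simp
  have hpb : p ∣ b := hp.dvd_of_dvd_pow ((dvd_pow_self p hjpos.ne').trans hj)
  exact (pow_dvd_pow p ((hp.pow_dvd_iff_le_factorization (pow_ne_zero k hb)).mp hj)).trans
    (Int.natCast_dvd.mp (h p (Nat.mem_primeFactors.mpr ⟨hp, hpb, hb⟩)))

/-- A set of integers coprime to `b`, contained in a short interval and whose squares agree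
modulo `b ^ k`, has boundedly many elements. -/
theorem card_le_of_sq_congr {b k W : ℕ} (hb : 2 ≤ b) (F : Finset ℕ)
    (hcop : ∀ d ∈ F, d.Coprime b)
    (hsq : ∀ d ∈ F, ∀ e ∈ F, ((b ^ k : ℕ) : ℤ) ∣ ((d : ℤ) - e) * (d + e))
    (hW : ∀ d ∈ F, ∀ e ∈ F, (d : ℤ) - e ≤ W * (b ^ k : ℕ)) :
    F.card ≤ 2 ^ b.primeFactors.card * (4 * W + 1) := by
  classical
  rcases F.eq_empty_or_nonempty with rfl | ⟨e, he⟩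
  · simp
  have hq : (0 : ℤ) < (b ^ k : ℕ) := by positivity
  let T : ℕ → Finset ℕ := fun d ↦ b.primeFactors.filter
    fun p ↦ ((p ^ (b ^ k).factorization p : ℕ) : ℤ) ∣ 2 * ((d : ℤ) - e)
  let t : Finset (Finset ℕ × ℤ) := b.primeFactors.powerset ×ˢ Finset.Icc (-(2 * W : ℤ)) (2 * W)
  have ht : t.card = 2 ^ b.primeFactors.card * (4 * W + 1) := by
    simp only [t, Finset.card_product, Finset.card_powerset, Int.card_Icc]
    congr 1
    omega
  rw [← ht]
  refine Finset.card_le_card_of_injOn (fun d ↦ (T d, (2 * ((d : ℤ) - e)) / (b ^ k : ℕ))) ?_ ?_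
  · intro d hd
    simp only [t, Finset.coe_product, Set.mem_prod, Finset.mem_coe, Finset.mem_powerset,
      Finset.mem_Icc]
    refine ⟨Finset.filter_subset _ _, ?_, ?_⟩
    · rw [Int.le_ediv_iff_mul_le hq]
      linarith [hW e he d hd]
    · refine Int.ediv_le_of_le_mul hq ?_
      linarith [hW d hd e he]
  · intro d hd d' hd' hdd
    simp only [Prod.mk.injEq] at hdd
    obtain ⟨hT, hfl⟩ := hdd
    have hdvd : ((b ^ k : ℕ) : ℤ) ∣ 2 * ((d : ℤ) - d') := by
      refine pow_dvd_of_forall_primeFactors (by omega) fun p hp ↦ ?_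
      have hpp := Nat.prime_of_mem_primeFactors hp
      have hiff : ((p ^ (b ^ k).factorization p : ℕ) : ℤ) ∣ 2 * ((d : ℤ) - e) ↔
          ((p ^ (b ^ k).factorization p : ℕ) : ℤ) ∣ 2 * ((d' : ℤ) - e) := by
        have := congrArg (p ∈ ·) hT
        simpa [T, hp] using this
      have key : ∀ c ∈ F, ((p ^ (b ^ k).factorization p : ℕ) : ℤ) ∣ 2 * ((c : ℤ) - e) ∨
          ((p ^ (b ^ k).factorization p : ℕ) : ℤ) ∣ 2 * ((c : ℤ) + e) := by
        intro c hc
        have hpc : ¬ (p : ℤ) ∣ (c : ℤ) := by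
          intro h
          exact Nat.not_coprime_of_dvd_of_dvd hpp.one_lt (Int.natCast_dvd_natCast.mp h)
            (Nat.dvd_of_mem_primeFactors hp) (hcop c hc)
        rw [Nat.cast_pow]
        refine prime_pow_dvd_two_mul_or_of_dvd_mul hpp _ hpc (by ring) ?_
        refine dvd_trans ?_ (hsq c hc e he)
        rw [← Nat.cast_pow]
        exact Int.natCast_dvd_natCast.mpr (Nat.ordProj_dvd _ _)
      by_cases h : ((p ^ (b ^ k).factorization p : ℕ) : ℤ) ∣ 2 * ((d : ℤ) - e)
      · have h' := dvd_sub h (hiff.mp h)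
        rwa [← mul_sub, sub_sub_sub_cancel_right] at h'
      · have h1 := (key d hd).resolve_left h
        have h2 := (key d' hd').resolve_left (mt hiff.mpr h)
        have h' := dvd_sub h1 h2
        rwa [← mul_sub, add_sub_add_right_eq_sub] at h'
    have hmod : (2 * ((d : ℤ) - e)) % (b ^ k : ℕ) = (2 * ((d' : ℤ) - e)) % (b ^ k : ℕ) := by
      rw [Int.emod_eq_emod_iff_emod_sub_eq_zero, ← mul_sub, sub_sub_sub_cancel_right]
      exact Int.emod_eq_zero_of_dvd hdvd
    have h1 := Int.mul_ediv_add_emod (2 * ((d : ℤ) - e)) (b ^ k : ℕ)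
    have h2 := Int.mul_ediv_add_emod (2 * ((d' : ℤ) - e)) (b ^ k : ℕ)
    rw [hfl, hmod] at h1
    omega

/-- The length and the `k` leading digits of a palindrome determine its `k` trailing digits. -/
theorem mod_pow_eq_of_palindrome {b n n' k : ℕ} (hb : 2 ≤ b)
    (hn : (Nat.digits b n).Palindrome) (hn' : (Nat.digits b n').Palindrome)
    (hlen : (Nat.digits b n).length = (Nat.digits b n').length)
    (hk : k ≤ (Nat.digits b n).length)
    (hdiv : n / b ^ ((Nat.digits b n).length - k) = n' / b ^ ((Nat.digits b n).length - k)) :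
    n % b ^ k = n' % b ^ k := by
  have hdrop : (Nat.digits b n).drop ((Nat.digits b n).length - k) =
      (Nat.digits b n').drop ((Nat.digits b n).length - k) := by
    refine Nat.ofDigits_inj_of_len_eq (b := b) hb (by simp [hlen])
      (fun l hl ↦ Nat.digits_lt_base hb (List.mem_of_mem_drop hl))
      (fun l hl ↦ Nat.digits_lt_base hb (List.mem_of_mem_drop hl)) ?_
    rwa [← Nat.self_div_pow_eq_ofDigits_drop _ _ hb, ← Nat.self_div_pow_eq_ofDigits_drop _ _ hb]
  have htake : (Nat.digits b n).take k = (Nat.digits b n').take k := by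
    have := congrArg List.reverse hdrop
    rw [List.reverse_drop, List.reverse_drop, hn.reverse_eq, hn'.reverse_eq, ← hlen,
      Nat.sub_sub_self hk] at this
    exact this
  rw [Nat.self_mod_pow_eq_ofDigits_take _ _ hb, Nat.self_mod_pow_eq_ofDigits_take _ _ hb, htake]

theorem sub_le_of_div_eq {b k N m D d e : ℕ} (hD : b ^ k * b ^ k ≤ D)
    (hD' : D < (b ^ k * b) * (b ^ k * b)) (hb : 2 ≤ b) (hm : 0 < m) (hk : k ≤ N + 1)
    (hd : D ≤ d) (he : D ≤ e) (he' : e ≤ 2 * D) (hN : b ^ N ≤ m * e ^ 2)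
    (hdiv : m * d ^ 2 / b ^ (N + 1 - k) = m * e ^ 2 / b ^ (N + 1 - k)) :
    (d : ℤ) - e ≤ (2 * b ^ 3 : ℕ) * (b ^ k : ℕ) := by
  have hB : 0 < b ^ (N + 1 - k) := by positivity
  have hBq : b ^ (N + 1 - k) * b ^ k = b ^ N * b := by
    rw [← pow_add, ← pow_succ]
    congr 1
    omega
  have hlt : m * d ^ 2 < m * e ^ 2 + b ^ (N + 1 - k) := by
    have h1 := Nat.lt_mul_div_succ (m * d ^ 2) hB
    have h2 := Nat.mul_div_le (m * e ^ 2) (b ^ (N + 1 - k))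
    rw [hdiv, mul_add] at h1
    omega
  by_contra! hcon
  have hDpos : 0 < D := lt_of_lt_of_le (by positivity) hD
  have hle : e + 2 * b ^ 3 * b ^ k ≤ d := by zify; push_cast at hcon ⊢; linarith
  obtain ⟨s, rfl⟩ := Nat.exists_eq_add_of_le hle
  set q := b ^ k with hq
  set B := b ^ (N + 1 - k) with hBdef
  have hqpos : 0 < q := by positivity
  have h3 : m * (2 * b ^ 3 * q) * (2 * D) ≤ B := by
    have : m * (2 * b ^ 3 * q) * (2 * D) ≤ m * (2 * b ^ 3 * q) * (2 * e) := by gcongr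
    nlinarith [Nat.zero_le (m * (2 * b ^ 3 * q + s) ^ 2), Nat.zero_le (m * e * s)]
  have h4 : m * (2 * b ^ 3 * q) * (2 * D) * q ≤ 4 * m * D * D * b := by
    calc m * (2 * b ^ 3 * q) * (2 * D) * q ≤ B * q := by gcongr
      _ = b ^ N * b := hBq
      _ ≤ m * e ^ 2 * b := by gcongr
      _ ≤ m * (2 * D) ^ 2 * b := by gcongr
      _ = _ := by ring
  have h5 : (4 * m * D * b) * ((q * b) * (q * b)) ≤ (4 * m * D * b) * D := by
    calc _ = m * (2 * b ^ 3 * q) * (2 * D) * q := by ring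
      _ ≤ _ := h4
      _ = _ := by ring
  exact absurd (Nat.le_of_mul_le_mul_left h5 (by positivity)) (by omega)

/-- For fixed `m`, few `d` in a dyadic range make `m * d ^ 2` a palindrome coprime to `b`. -/
theorem card_palindrome_mul_sq_le {b k m D : ℕ} (hb : 2 ≤ b) (hm : 0 < m)
    (hD : b ^ k * b ^ k ≤ D) (hD' : D < (b ^ k * b) * (b ^ k * b)) (F : Finset ℕ)
    (hF : ∀ d ∈ F, d ∈ Finset.Icc D (2 * D) ∧ (Nat.digits b (m * d ^ 2)).Palindrome ∧
      (m * d ^ 2).Coprime b) :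
    F.card ≤ 2 ^ b.primeFactors.card * (4 * (2 * b ^ 3) + 1) * (3 * b ^ k) := by
  classical
  have hDpos : 0 < D := lt_of_lt_of_le (by positivity) hD
  have hpos : ∀ d ∈ F, m * d ^ 2 ≠ 0 := by
    intro d hd
    have := (Finset.mem_Icc.mp (hF d hd).1).1
    have : 0 < d := by omega
    positivity
  have hlen : ∀ d ∈ F, (Nat.digits b (m * d ^ 2)).length = Nat.log b (m * d ^ 2) + 1 :=
    fun d hd ↦ Nat.length_digits b _ hb (hpos d hd)
  have hklog : ∀ d ∈ F, k ≤ Nat.log b (m * d ^ 2) := by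
    intro d hd
    refine Nat.le_log_of_pow_le hb ?_
    have := (Finset.mem_Icc.mp (hF d hd).1).1
    calc b ^ k ≤ b ^ k * b ^ k := Nat.le_mul_of_pos_left _ (by positivity)
      _ ≤ d := hD.trans this
      _ ≤ d ^ 2 := Nat.le_self_pow two_ne_zero d
      _ ≤ m * d ^ 2 := Nat.le_mul_of_pos_left _ hm
  let N := Nat.log b (m * D ^ 2)
  let t : Finset (ℕ × ℕ) := Finset.Icc N (N + 2) ×ˢ Finset.range (b ^ k)
  have ht : t.card = 3 * b ^ k := by
    simp only [t, Finset.card_product, Nat.card_Icc, Finset.card_range]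
    congr 1
    omega
  rw [← ht]
  refine Finset.card_le_mul_card_image_of_maps_to
    (f := fun d ↦ (Nat.log b (m * d ^ 2),
      m * d ^ 2 / b ^ (Nat.log b (m * d ^ 2) + 1 - k))) ?_ _ ?_
  · intro d hd
    have hdD := Finset.mem_Icc.mp (hF d hd).1
    simp only [t, Finset.mem_product, Finset.mem_Icc, Finset.mem_range]
    refine ⟨⟨Nat.log_mono_right (by gcongr; exact hdD.1), ?_⟩, ?_⟩
    · rw [← Nat.lt_succ_iff]
      refine Nat.log_lt_of_lt_pow (hpos d hd) ?_
      have h1 := Nat.lt_pow_succ_log_self hb (m * D ^ 2)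
      calc m * d ^ 2 ≤ m * (2 * D) ^ 2 := by gcongr; exact hdD.2
        _ = 2 ^ 2 * (m * D ^ 2) := by ring
        _ ≤ b ^ 2 * (m * D ^ 2) := by gcongr
        _ < b ^ 2 * b ^ (N + 1) := by gcongr
        _ = b ^ (N + 2).succ := by rw [Nat.succ_eq_add_one]; ring
    · have hk := hklog d hd
      rw [Nat.div_lt_iff_lt_mul (by positivity), ← pow_add,
        show k + (Nat.log b (m * d ^ 2) + 1 - k) = (Nat.log b (m * d ^ 2)).succ by omega]
      exact Nat.lt_pow_succ_log_self hb _
  · rintro ⟨L, Q⟩ -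
    refine card_le_of_sq_congr (k := k) hb _ ?_ ?_ ?_
    · intro d hd
      exact ((hF d (Finset.mem_filter.mp hd).1).2.2.coprime_dvd_left
        ((dvd_pow_self d two_ne_zero).mul_left m))
    · intro d hd e he
      simp only [Finset.mem_filter, Prod.mk.injEq] at hd he
      obtain ⟨hd, hdL, hdQ⟩ := hd
      obtain ⟨he, heL, heQ⟩ := he
      have hld := hlen d hd
      have hle := hlen e he
      have hk := hklog d hd
      have hmod : m * d ^ 2 % b ^ k = m * e ^ 2 % b ^ k := by
        refine mod_pow_eq_of_palindrome hb (hF d hd).2.1 (hF e he).2.1 (by omega) (by omega) ?_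
        rw [hld, hdQ, hdL, ← heL, heQ]
      have hdvd := (Nat.modEq_iff_dvd.mp (show m * e ^ 2 ≡ m * d ^ 2 [MOD b ^ k] from hmod.symm))
      have hcop : IsCoprime ((b ^ k : ℕ) : ℤ) (m : ℤ) :=
        Nat.isCoprime_iff_coprime.mpr
          (((hF d hd).2.2.coprime_dvd_left (dvd_mul_right m _)).symm.pow_left k)
      refine hcop.dvd_of_dvd_mul_left ?_
      rw [show (m : ℤ) * (((d : ℤ) - e) * (d + e)) = (m * d ^ 2 : ℕ) - (m * e ^ 2 : ℕ) by
        push_cast; ring]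
      exact hdvd
    · intro d hd e he
      simp only [Finset.mem_filter, Prod.mk.injEq] at hd he
      obtain ⟨hd, hdL, hdQ⟩ := hd
      obtain ⟨he, heL, heQ⟩ := he
      have hdD := Finset.mem_Icc.mp (hF d hd).1
      have heD := Finset.mem_Icc.mp (hF e he).1
      have hk := hklog d hd
      refine sub_le_of_div_eq (N := L) hD hD' hb hm (by omega) hdD.1 heD.1 heD.2 ?_ ?_
      · rw [← heL]
        exact Nat.pow_log_le_self b (hpos e he)
      · rw [hdL] at hdQ
        rw [heL] at heQ
        rw [hdQ, heQ]

theorem exists_pow_sq_le_lt {b D : ℕ} (hb : 2 ≤ b) (hD : 0 < D) :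
    ∃ k, b ^ k * b ^ k ≤ D ∧ D < (b ^ k * b) * (b ^ k * b) := by
  refine ⟨Nat.log b D.sqrt, ?_, ?_⟩
  · exact Nat.le_sqrt.mp (Nat.pow_log_le_self b (Nat.sqrt_pos.mpr hD).ne')
  · rw [← pow_succ]
    exact Nat.sqrt_lt.mp (Nat.lt_pow_succ_log_self hb _)

theorem Scount_le_card_mul (b : ℕ) (x D : ℝ) (hx : 0 ≤ x) (hD : 0 < D) (K : ℕ)
    (hK : ∀ m : ℕ, 0 < m → ∀ F : Finset ℕ,
      (∀ d ∈ F, d ∈ Finset.Icc ⌈D⌉₊ (2 * ⌈D⌉₊) ∧ (Nat.digits b (m * d ^ 2)).Palindrome ∧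
        (m * d ^ 2).Coprime b) → F.card ≤ K) :
    (Scount b x D : ℝ) ≤ x / D ^ 2 * K := by
  classical
  let A : ℕ → Finset ℕ := fun m ↦ (Finset.Icc ⌈D⌉₊ (2 * ⌈D⌉₊)).filter fun d ↦
    (Nat.digits b (m * d ^ 2)).Palindrome ∧ (m * d ^ 2).Coprime b
  let I := Finset.Icc 1 ⌊x / D ^ 2⌋₊
  have hsub : {n : ℕ | n ∈ PstarSet b x ∧ ∃ d : ℕ, D ≤ (d : ℝ) ∧ (d : ℝ) ≤ 2 * D ∧ d ^ 2 ∣ n} ⊆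
      (I.biUnion fun m ↦ (A m).image fun d ↦ m * d ^ 2 : Finset ℕ) := by
    rintro n ⟨⟨hn, hnx, ⟨-, hpal⟩, hgcd⟩, d, hDd, hdD, m, rfl⟩
    rw [mul_comm] at hn hnx hpal hgcd
    have hm : 0 < m := pos_of_mul_pos_left hn (Nat.zero_le _)
    simp only [Finset.coe_biUnion, Finset.coe_image, Set.mem_iUnion, Set.mem_image, Finset.mem_coe]
    refine ⟨m, ?_, d, ?_, mul_comm _ _⟩
    · refine Finset.mem_Icc.mpr ⟨hm, Nat.le_floor ?_⟩
      rw [le_div_iff₀ (by positivity)]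
      push_cast at hnx
      refine le_trans ?_ hnx
      gcongr
    · refine Finset.mem_filter.mpr ⟨Finset.mem_Icc.mpr ⟨Nat.ceil_le.mpr hDd, ?_⟩, hpal, ?_⟩
      · have : (d : ℝ) ≤ (2 * ⌈D⌉₊ : ℕ) := by
          push_cast
          linarith [Nat.le_ceil D]
        exact_mod_cast this
      · refine Nat.Coprime.coprime_dvd_right ?_ hgcd
        exact Nat.dvd_sub (dvd_pow_self b three_ne_zero) dvd_rfl
  have hcard : Scount b x D ≤ I.card * K := by
    refine (Set.ncard_le_ncard hsub (Finset.finite_toSet _)).trans ?_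
    rw [Set.ncard_coe_finset]
    refine Finset.card_biUnion_le_card_mul _ _ _ fun m hm ↦ Finset.card_image_le.trans ?_
    exact hK m (Finset.mem_Icc.mp hm).1 (A m) fun d hd ↦ Finset.mem_filter.mp hd
  calc (Scount b x D : ℝ) ≤ (I.card * K : ℕ) := by exact_mod_cast hcard
    _ = (⌊x / D ^ 2⌋₊ : ℝ) * K := by simp [I]
    _ ≤ x / D ^ 2 * K := by
      gcongr
      exact Nat.floor_le (by positivity)

/-- For all `b ≥ 2`, `x ≥ 1` and `D ≥ 1`, `S_b(x,D) ≪_b x / D^{3/2}`. -/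
theorem Scount_le_of_large_D (b : ℕ) (hb : 2 ≤ b) :
    ∃ C : ℝ, ∀ x D : ℝ, 1 ≤ x → 1 ≤ D →
      (Scount b x D : ℝ) ≤ C * x / D ^ ((3 : ℝ) / 2) := by
  let K : ℕ := 2 ^ b.primeFactors.card * (4 * (2 * b ^ 3) + 1)
  refine ⟨6 * K, fun x D hx hD ↦ ?_⟩
  have hD0 : 0 < D := by linarith
  obtain ⟨k, hk, hk'⟩ := exists_pow_sq_le_lt hb (Nat.ceil_pos.mpr hD0)
  have hmain := Scount_le_card_mul b x D (by linarith) hD0 (K * (3 * b ^ k))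
    fun m hm F hF ↦ card_palindrome_mul_sq_le hb hm hk hk' F hF
  have hq : ((b ^ k : ℕ) : ℝ) ≤ 2 * √D := by
    have h1 : ((b ^ k : ℕ) : ℝ) * (b ^ k : ℕ) ≤ ⌈D⌉₊ := by exact_mod_cast hk
    have h2 := Nat.ceil_lt_add_one hD0.le
    refine abs_le_of_sq_le_sq' ?_ (by positivity) |>.2
    rw [mul_pow, Real.sq_sqrt hD0.le]
    nlinarith
  have hpow : D ^ ((3 : ℝ) / 2) * √D = D ^ 2 := by
    rw [Real.sqrt_eq_rpow, ← Real.rpow_add hD0, ← Real.rpow_natCast]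
    norm_num
  have hpos : 0 < D ^ ((3 : ℝ) / 2) := by positivity
  calc (Scount b x D : ℝ) ≤ x / D ^ 2 * (K * (3 * b ^ k) : ℕ) := hmain
    _ = x / D ^ 2 * (K * (3 * (b ^ k : ℕ))) := by push_cast; ring
    _ ≤ x / D ^ 2 * (K * (3 * (2 * √D))) := by gcongr
    _ = 6 * K * x / D ^ ((3 : ℝ) / 2) := by
      rw [← hpow]
      field_simp
      ring
end
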